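/- Let d ≥ 3 and v : ℝ^d → ℝ be nonnegative, bounded, measurable with bounded support, with critical threshold α₁ ∈ (0,∞) for finiteness of E[e^{α Y_x}] (Y_x = ∫₀^∞ v(W_x(s))ds). Suppose x(t) → x and y(t) → y in ℝ^d and Z(t) is the path integral of v along the Brownian bridge from x(t) to y(t) in time t. Then for every α < α₁, E[e^{α Z(t)}] → E[e^{α Y_x}] E[e^{α Y_y}] as t → ∞. -/

import Mathlib

open MeasureTheory Real Filter Topology ProbabilityTheory

noncomputable section

/-- Euclidean space `ℝ^d`. -/
abbrev Euc (d : ℕ) := EuclideanSpace ℝ (Fin d)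

/-- The Brownian transition density `q(s; w) = (2πs)^{-d/2} exp(-|w|²/(2s))`. -/
def heatKernel (d : ℕ) (s : ℝ) (w : Euc d) : ℝ :=
  (2 * π * s) ^ (-(d : ℝ) / 2) * Real.exp (-‖w‖ ^ 2 / (2 * s))

/-- Joint density of a Brownian motion started at `x`, at times `s 0 < s 1 < ⋯`. -/
def jointDensity (d : ℕ) {k : ℕ} (x : Euc d) (s : Fin k → ℝ) (z : Fin k → Euc d) : ℝ :=
  ∏ j : Fin k,
    heatKernel d (s j - if (j : ℕ) = 0 then 0 else s ⟨(j : ℕ) - 1, lt_of_le_of_lt (Nat.sub_le _ _) j.isLt⟩)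
      (z j - if (j : ℕ) = 0 then x else z ⟨(j : ℕ) - 1, lt_of_le_of_lt (Nat.sub_le _ _) j.isLt⟩)

/-- Joint density of the Brownian bridge from `a` to `b` in time `t`, at interior times `s`. -/
def bridgeDensity (d : ℕ) {k : ℕ} (t : ℝ) (a b : Euc d) (s : Fin k → ℝ) (z : Fin k → Euc d) : ℝ :=
  jointDensity d a (Fin.snoc s t) (Fin.snoc z b) / heatKernel d t (b - a)

/-- The open ordered simplex `0 < s₁ < ⋯ < s_k < t`. -/
def simplex (k : ℕ) (t : ℝ) : Set (Fin k → ℝ) :=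
  {s | StrictMono s ∧ ∀ i, 0 < s i ∧ s i < t}

/-- `W` is a standard `d`-dimensional Brownian motion started at `x`, characterized by
continuous paths and finite-dimensional densities given by products of heat kernels. -/
def IsBrownianMotion {Ω : Type*} [MeasureSpace Ω] {d : ℕ} (x : Euc d)
    (W : ℝ → Ω → Euc d) : Prop :=
  (∀ ω, W 0 ω = x) ∧ (∀ ω, Continuous fun s => W s ω) ∧
  ∀ (k : ℕ) (s : Fin (k + 1) → ℝ), StrictMono s → (∀ i, 0 < s i) →
    Measure.map (fun ω (i : Fin (k + 1)) => W (s i) ω) (ℙ : Measure Ω) =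
      (volume : Measure (Fin (k + 1) → Euc d)).withDensity
        (fun z => ENNReal.ofReal (jointDensity d x s z))

/-- `X` is a `d`-dimensional Brownian bridge from `a` to `b` in time `t`. -/
def IsBrownianBridge {Ω : Type*} [MeasureSpace Ω] {d : ℕ} (t : ℝ) (a b : Euc d)
    (X : ℝ → Ω → Euc d) : Prop :=
  (∀ ω, X 0 ω = a) ∧ (∀ ω, X t ω = b) ∧
  (∀ ω, ContinuousOn (fun s => X s ω) (Set.Icc 0 t)) ∧
  ∀ (k : ℕ) (s : Fin (k + 1) → ℝ), StrictMono s → (∀ i, 0 < s i ∧ s i < t) →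
    Measure.map (fun ω (i : Fin (k + 1)) => X (s i) ω) (ℙ : Measure Ω) =
      (volume : Measure (Fin (k + 1) → Euc d)).withDensity
        (fun z => ENNReal.ofReal (bridgeDensity d t a b s z))

/-- The path integral `∫₀^t v(X_s) ds`. -/
def pathInt {Ω : Type*} {d : ℕ} (v : Euc d → ℝ) (X : ℝ → Ω → Euc d) (t : ℝ) (ω : Ω) : ℝ :=
  ∫ s in Set.Ioc (0 : ℝ) t, v (X s ω)

/-- The total path integral `∫₀^∞ v(X_s) ds`. -/
def pathIntInf {Ω : Type*} {d : ℕ} (v : Euc d → ℝ) (X : ℝ → Ω → Euc d) (ω : Ω) : ℝ :=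
  ∫ s in Set.Ioi (0 : ℝ), v (X s ω)

/-- The density ratio `Q_{j} = q(t; y - x)/q(Δ_j s; Δ_j z)` with the conventions
`s₀ = 0`, `s_{k+1} = t`, `z₀ = x`, `z_{k+1} = y`. -/
def Qratio (d : ℕ) {k : ℕ} (t : ℝ) (x y : Euc d) (s : Fin k → ℝ) (z : Fin k → Euc d)
    (j : Fin (k + 1)) : ℝ :=
  heatKernel d t (y - x) /
    heatKernel d
      ((Fin.cons 0 (Fin.snoc s t) : Fin (k + 2) → ℝ) j.succ -
        (Fin.cons 0 (Fin.snoc s t) : Fin (k + 2) → ℝ) j.castSucc)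
      ((Fin.cons x (Fin.snoc z y) : Fin (k + 2) → Euc d) j.succ -
        (Fin.cons x (Fin.snoc z y) : Fin (k + 2) → Euc d) j.castSucc)

/-- Fubini for the first coordinate of a function on a finite power. -/
theorem lintegral_fin_succ {α : Type*} [MeasureSpace α] [SigmaFinite (volume : Measure α)]
    {k : ℕ} {F : (Fin (k + 1) → α) → ENNReal} (hF : Measurable F) :
    ∫⁻ s, F s = ∫⁻ r : α, ∫⁻ s : Fin k → α, F (Fin.cons r s) := by
  have h := (volume_preserving_piFinSuccAbove (fun _ : Fin (k + 1) => α) 0).symm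
  rw [← h.lintegral_comp hF, Measure.volume_eq_prod, lintegral_prod]
  · simp [MeasurableEquiv.piFinSuccAbove, Fin.insertNthEquiv]
  · exact (hF.comp h.measurable).aemeasurable

/-- The integral of a product function on a finite power is a power of the integral. -/
theorem lintegral_prod_fin_eq_pow {α : Type*} [MeasureSpace α] [SigmaFinite (volume : Measure α)]
    {f : α → ENNReal} (hf : Measurable f) (k : ℕ) :
    ∫⁻ s : Fin k → α, ∏ i, f (s i) = (∫⁻ r, f r) ^ k := by
  induction k with
  | zero =>
    simp [volume_pi]
  | succ k ih =>
    rw [lintegral_fin_succ (by fun_prop), pow_succ', ← lintegral_mul_const _ hf]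
    refine lintegral_congr fun r => ?_
    simp only [Fin.prod_univ_succ, Fin.cons_zero, Fin.cons_succ]
    rw [lintegral_const_mul _ (by fun_prop), ih]

theorem measurableSet_strictMono_fin (k : ℕ) : MeasurableSet {s : Fin k → ℝ | StrictMono s} := by
  have : {s : Fin k → ℝ | StrictMono s} = ⋂ i, ⋂ j, {s | i < j → s i < s j} := by
    ext s; simp [StrictMono]
  rw [this]
  refine MeasurableSet.iInter fun i => MeasurableSet.iInter fun j => ?_
  by_cases h : i < j
  · simp only [h, true_imp_iff]
    exact measurableSet_lt (measurable_pi_apply i) (measurable_pi_apply j)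
  · simp [h]

theorem ae_injective_fin (k : ℕ) : ∀ᵐ s : Fin k → ℝ, Function.Injective s := by
  have : ∀ i j : Fin k, ∀ᵐ s : Fin k → ℝ, s i = s j → i = j := by
    intro i j
    by_cases hij : i = j
    · simp [hij]
    · simp only [hij, imp_false]
      let L : (Fin k → ℝ) →ₗ[ℝ] ℝ :=
        LinearMap.proj (R := ℝ) (φ := fun _ : Fin k => ℝ) i - LinearMap.proj j
      have hne : LinearMap.ker L ≠ ⊤ := by
        intro h
        have h1 : L (Pi.single i 1) = 0 := by
          have : (Pi.single i 1 : Fin k → ℝ) ∈ LinearMap.ker L := by rw [h]; trivial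
          simpa using this
        simp [L, Ne.symm hij] at h1
      have h0 := Measure.addHaar_submodule (volume : Measure (Fin k → ℝ)) (LinearMap.ker L) hne
      rw [ae_iff]
      convert h0 using 2
      ext s
      simp [L, sub_eq_zero]
  have h2 := ae_all_iff.2 fun i => ae_all_iff.2 (this i)
  filter_upwards [h2] with s hs i j h using hs i j h

/-- The integral of a product function over the cube is `k!` times its integral over the set of
increasing sequences. -/
theorem pow_lintegral_eq_factorial_mul {f : ℝ → ENNReal} (hf : Measurable f) (k : ℕ) :
    (∫⁻ r, f r) ^ k =
      (k.factorial : ENNReal) *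
        ∫⁻ s : Fin k → ℝ, {s : Fin k → ℝ | StrictMono s}.indicator (fun s => ∏ i, f (s i)) s := by
  set S : Set (Fin k → ℝ) := {s | StrictMono s} with hS
  have hSm : MeasurableSet S := measurableSet_strictMono_fin k
  have hFm : Measurable (fun s : Fin k → ℝ => ∏ i, f (s i)) := by fun_prop
  have key : ∀ᵐ s : Fin k → ℝ, ∏ i, f (s i) =
      ∑ σ : Equiv.Perm (Fin k), S.indicator (fun s => ∏ i, f (s i)) (s ∘ σ) := by
    filter_upwards [ae_injective_fin k] with s hs
    have hmono : StrictMono (s ∘ Tuple.sort s) :=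
      (Tuple.monotone_sort s).strictMono_of_injective (hs.comp (Tuple.sort s).injective)
    rw [Finset.sum_eq_single (Tuple.sort s)]
    · rw [Set.indicator_of_mem (by exact hmono)]
      exact (Equiv.prod_comp (Tuple.sort s) (fun i => f (s i))).symm
    · intro τ _ hτ
      apply Set.indicator_of_notMem
      intro hmem
      apply hτ
      have hr : s ∘ τ = s ∘ Tuple.sort s := by
        have hmem' : StrictMono (s ∘ τ) := hmem
        refine (StrictMono.range_inj hmem' hmono).1 ?_
        rw [τ.surjective.range_comp, (Tuple.sort s).surjective.range_comp]
      ext i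
      exact congrArg Fin.val (hs (congrFun hr i))
    · simp
  rw [← lintegral_prod_fin_eq_pow hf, lintegral_congr_ae key, lintegral_finsetSum]
  · have : ∀ σ : Equiv.Perm (Fin k),
        ∫⁻ s : Fin k → ℝ, S.indicator (fun s => ∏ i, f (s i)) (s ∘ σ) =
          ∫⁻ s, S.indicator (fun s => ∏ i, f (s i)) s := by
      intro σ
      have h := volume_measurePreserving_piCongrLeft (fun _ : Fin k => ℝ) σ.symm
      rw [← h.lintegral_comp (hFm.indicator hSm)]
      refine lintegral_congr fun s => ?_
      congr 1
      ext i
      have := MeasurableEquiv.piCongrLeft_apply_apply (β := fun _ => ℝ) σ.symm s (σ i)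
      simpa using this.symm
    simp only [this]
    simp [Fintype.card_perm]
  · intro σ _
    exact (hFm.indicator hSm).comp (by fun_prop)

theorem heatKernel_nonneg (d : ℕ) {s : ℝ} (hs : 0 ≤ s) (w : Euc d) : 0 ≤ heatKernel d s w := by
  unfold heatKernel; positivity

theorem heatKernel_pos (d : ℕ) {s : ℝ} (hs : 0 < s) (w : Euc d) : 0 < heatKernel d s w := by
  unfold heatKernel; positivity

theorem heatKernel_neg (d : ℕ) (s : ℝ) (w : Euc d) : heatKernel d s (-w) = heatKernel d s w := by
  simp [heatKernel]

theorem measurable_heatKernel (d : ℕ) :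
    Measurable (fun p : ℝ × Euc d => heatKernel d p.1 p.2) := by
  unfold heatKernel; fun_prop

@[fun_prop]
theorem Measurable.heatKernel {α : Type*} [MeasurableSpace α] {d : ℕ} {f : α → ℝ} {g : α → Euc d}
    (hf : Measurable f) (hg : Measurable g) :
    Measurable (fun a => _root_.heatKernel d (f a) (g a)) :=
  (measurable_heatKernel d).comp (hf.prodMk hg)

/-- The weight of a Brownian step from the space-time point `p` to the space-time point `q`,
multiplied by `v` at the arrival point, where the arrival time lies in `A` and the duration
in `S`. -/
def visitKernel (d : ℕ) (v : Euc d → ℝ) (A S : Set ℝ) (p q : ℝ × Euc d) : ENNReal :=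
  A.indicator 1 q.1 * (S.indicator 1 (q.1 - p.1) *
    (ENNReal.ofReal (heatKernel d (q.1 - p.1) (q.2 - p.2)) * ENNReal.ofReal (v q.2)))

/-- The integral operator with kernel `visitKernel`. -/
def visitStep (d : ℕ) (v : Euc d → ℝ) (A S : Set ℝ) (φ : ℝ × Euc d → ENNReal)
    (p : ℝ × Euc d) : ENNReal :=
  ∫⁻ q, visitKernel d v A S p q * φ q

@[fun_prop]
theorem measurable_visitKernel {d : ℕ} {v : Euc d → ℝ} (hv : Measurable v) {A S : Set ℝ}
    (hA : MeasurableSet A) (hS : MeasurableSet S) :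
    Measurable (fun x : (ℝ × Euc d) × (ℝ × Euc d) => visitKernel d v A S x.1 x.2) := by
  have h1 : Measurable (A.indicator (1 : ℝ → ENNReal)) := measurable_one.indicator hA
  have h2 : Measurable (S.indicator (1 : ℝ → ENNReal)) := measurable_one.indicator hS
  unfold visitKernel
  fun_prop

theorem measurable_visitKernel_comp {α : Type*} [MeasurableSpace α] {d : ℕ} {v : Euc d → ℝ}
    (hv : Measurable v) {A S : Set ℝ} (hA : MeasurableSet A) (hS : MeasurableSet S)
    {f g : α → ℝ × Euc d} (hf : Measurable f) (hg : Measurable g) :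
    Measurable (fun x => visitKernel d v A S (f x) (g x)) :=
  (measurable_visitKernel hv hA hS).comp (hf.prodMk hg)

theorem measurable_visitStep_param {α : Type*} [MeasurableSpace α] {d : ℕ} {v : Euc d → ℝ}
    (hv : Measurable v) {A S : Set ℝ} (hA : MeasurableSet A) (hS : MeasurableSet S)
    {φ : α → ℝ × Euc d → ENNReal} (hφ : Measurable (Function.uncurry φ)) :
    Measurable (Function.uncurry fun a => visitStep d v A S (φ a)) := by
  unfold visitStep
  refine Measurable.lintegral_prod_right'
    (f := fun (x : (α × (ℝ × Euc d)) × (ℝ × Euc d)) =>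
      visitKernel d v A S x.1.2 x.2 * φ x.1.1 x.2) ?_
  refine Measurable.mul ?_ ?_
  · exact measurable_visitKernel_comp hv hA hS (by fun_prop) (by fun_prop)
  · exact hφ.comp (by fun_prop : Measurable fun x : (α × (ℝ × Euc d)) × (ℝ × Euc d) =>
      (x.1.1, x.2))

theorem measurable_visitStep_iterate_param {α : Type*} [MeasurableSpace α] {d : ℕ}
    {v : Euc d → ℝ} (hv : Measurable v) {A S : Set ℝ} (hA : MeasurableSet A)
    (hS : MeasurableSet S) {φ : α → ℝ × Euc d → ENNReal}
    (hφ : Measurable (Function.uncurry φ)) (k : ℕ) :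
    Measurable (Function.uncurry fun a => (visitStep d v A S)^[k] (φ a)) := by
  induction k with
  | zero => exact hφ
  | succ k ih =>
    simp only [Function.iterate_succ_apply']
    exact measurable_visitStep_param hv hA hS ih

theorem measurable_visitStep_iterate {d : ℕ} {v : Euc d → ℝ} (hv : Measurable v) {A S : Set ℝ}
    (hA : MeasurableSet A) (hS : MeasurableSet S) {φ : ℝ × Euc d → ENNReal}
    (hφ : Measurable φ) (k : ℕ) : Measurable ((visitStep d v A S)^[k] φ) := by
  have := measurable_visitStep_iterate_param (α := Unit) hv hA hS (φ := fun _ => φ)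
    (hφ.comp measurable_snd) k
  exact this.comp (measurable_prodMk_left (x := ()))

@[fun_prop]
theorem measurable_fin_cons {α β : Type*} [MeasurableSpace α] [MeasurableSpace β] {k : ℕ}
    {f : α → β} {g : α → Fin k → β} (hf : Measurable f) (hg : Measurable g) :
    Measurable fun a => (Fin.cons (f a) (g a) : Fin (k + 1) → β) := by
  refine measurable_pi_iff.2 fun i => ?_
  refine Fin.cases ?_ (fun j => ?_) i
  · simpa using hf
  · simp only [Fin.cons_succ]
    exact (measurable_pi_apply j).comp hg

theorem measurable_prod_visitKernel {α : Type*} [MeasurableSpace α] {d : ℕ} {v : Euc d → ℝ}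
    (hv : Measurable v) {A S : Set ℝ} (hA : MeasurableSet A) (hS : MeasurableSet S)
    {φ : ℝ × Euc d → ENNReal} (hφ : Measurable φ) {k : ℕ} {f : α → Fin (k + 1) → ℝ × Euc d}
    {g : α → Fin k → ℝ × Euc d} (hf : Measurable f) (hg : Measurable g) :
    Measurable fun a => (∏ i : Fin k, visitKernel d v A S (f a i.castSucc) (g a i)) *
      φ (f a (Fin.last k)) := by
  refine Measurable.mul ?_ (hφ.comp ((measurable_pi_apply _).comp hf))
  refine Finset.measurable_prod _ fun i _ => ?_
  exact measurable_visitKernel_comp hv hA hS ((measurable_pi_apply _).comp hf)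
    ((measurable_pi_apply _).comp hg)

/-- Iterating the visit operator unfolds to an integral over all visited space-time points. -/
theorem visitStep_iterate_eq {d : ℕ} {v : Euc d → ℝ} (hv : Measurable v) {A S : Set ℝ}
    (hA : MeasurableSet A) (hS : MeasurableSet S) {φ : ℝ × Euc d → ENNReal}
    (hφ : Measurable φ) (k : ℕ) (p : ℝ × Euc d) :
    (visitStep d v A S)^[k] φ p =
      ∫⁻ q : Fin k → ℝ × Euc d,
        (∏ i : Fin k, visitKernel d v A S ((Fin.cons p q : Fin (k + 1) → ℝ × Euc d) i.castSucc)
          (q i)) * φ ((Fin.cons p q : Fin (k + 1) → ℝ × Euc d) (Fin.last k)) := by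
  induction k generalizing p with
  | zero => simp [volume_pi]
  | succ k ih =>
    rw [Function.iterate_succ_apply', lintegral_fin_succ
      
      (measurable_prod_visitKernel hv hA hS hφ (by fun_prop) (by fun_prop))]
    refine lintegral_congr fun r => ?_
    rw [ih, ← lintegral_const_mul _
      (measurable_prod_visitKernel hv hA hS hφ (by fun_prop) (by fun_prop))]
    refine lintegral_congr fun q => ?_
    rw [Fin.prod_univ_succ, ← mul_assoc]
    simp [← Fin.succ_last]

theorem jointDensity_eq_prod_cons {d k : ℕ} (x : Euc d) (s : Fin k → ℝ) (z : Fin k → Euc d) :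
    jointDensity d x s z = ∏ j : Fin k,
      heatKernel d (s j - (Fin.cons 0 s : Fin (k + 1) → ℝ) j.castSucc)
        (z j - (Fin.cons x z : Fin (k + 1) → Euc d) j.castSucc) := by
  unfold jointDensity
  refine Finset.prod_congr rfl fun j _ => ?_
  cases k with
  | zero => exact j.elim0
  | succ k =>
    refine Fin.cases ?_ (fun i => ?_) j
    · simp
    · rw [← Fin.succ_castSucc]
      simp only [Fin.val_succ, Nat.succ_ne_zero, if_false, Fin.cons_succ, Nat.add_sub_cancel]
      rfl

theorem strictMono_cons_zero_iff {k : ℕ} {s : Fin k → ℝ} (hs : ∀ i, 0 < s i) :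
    StrictMono s ↔
      ∀ i : Fin k, (Fin.cons 0 s : Fin (k + 1) → ℝ) i.castSucc < s i := by
  cases k with
  | zero => simp [StrictMono]
  | succ k =>
    rw [Fin.strictMono_iff_lt_succ]
    constructor
    · intro h i
      refine Fin.cases ?_ (fun j => ?_) i
      · simpa using hs 0
      · rw [← Fin.succ_castSucc]; simpa using h j
    · intro h j
      have := h j.succ
      rw [← Fin.succ_castSucc] at this
      simpa using this

theorem measurable_jointDensity {d k : ℕ} (x : Euc d) (s : Fin k → ℝ) :
    Measurable (fun z : Fin k → Euc d => jointDensity d x s z) := by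
  simp only [jointDensity_eq_prod_cons]
  refine Finset.measurable_prod _ fun i _ => Measurable.heatKernel measurable_const ?_
  exact Measurable.sub (by fun_prop) ((measurable_pi_apply _).comp
      (measurable_fin_cons measurable_const measurable_id))

theorem prod_visitKernel_eq {d k : ℕ} (v : Euc d → ℝ) {A : Set ℝ} (hA : A ⊆ Set.Ioi 0)
    (x : Euc d) (s : Fin k → ℝ) (z : Fin k → Euc d) :
    (∏ i : Fin k, visitKernel d v A (Set.Ioi 0)
      ((Fin.cons (0, x) (fun i => (s i, z i)) : Fin (k + 1) → ℝ × Euc d) i.castSucc)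
        (s i, z i)) =
      {s : Fin k → ℝ | StrictMono s}.indicator 1 s * (∏ i, A.indicator 1 (s i)) *
        (ENNReal.ofReal (jointDensity d x s z) * ∏ i, ENNReal.ofReal (v (z i))) := by
  by_cases hsA : ∀ i, s i ∈ A
  swap
  · push Not at hsA
    obtain ⟨i, hi⟩ := hsA
    rw [Finset.prod_eq_zero (Finset.mem_univ i), Finset.prod_eq_zero (Finset.mem_univ i)]
    · simp
    · simp [hi]
    · simp [visitKernel, hi]
  have hc1 : ∀ j : Fin (k + 1), ((Fin.cons (0, x) (fun i => (s i, z i)) :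
      Fin (k + 1) → ℝ × Euc d) j).1 = (Fin.cons 0 s : Fin (k + 1) → ℝ) j := by
    intro j; refine Fin.cases ?_ (fun i => ?_) j <;> simp
  have hc2 : ∀ j : Fin (k + 1), ((Fin.cons (0, x) (fun i => (s i, z i)) :
      Fin (k + 1) → ℝ × Euc d) j).2 = (Fin.cons x z : Fin (k + 1) → Euc d) j := by
    intro j; refine Fin.cases ?_ (fun i => ?_) j <;> simp
  by_cases hs : StrictMono s
  · have hs' := (strictMono_cons_zero_iff fun i => hA (hsA i)).1 hs
    rw [jointDensity_eq_prod_cons, ENNReal.ofReal_prod_of_nonneg]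
    · simp only [visitKernel, hc1, hc2]
      simp [hs, hsA, hs', Finset.prod_mul_distrib]
    · intro i _
      exact heatKernel_nonneg d (sub_nonneg.2 (hs' i).le) _
  · have hs' := mt (strictMono_cons_zero_iff fun i => hA (hsA i)).2 hs
    push Not at hs'
    obtain ⟨i, hi⟩ := hs'
    rw [Finset.prod_eq_zero (Finset.mem_univ i)]
    · simp [hs]
    · have : s i - (Fin.cons 0 s : Fin (k + 1) → ℝ) i.castSucc ∉ Set.Ioi (0 : ℝ) := by
        simpa using hi
      simp only [visitKernel, hc1, Set.indicator_of_notMem this]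
      simp

theorem lintegral_prod_of_map_eq {Ω : Type*} [MeasureSpace Ω] {d : ℕ} {v : Euc d → ℝ}
    (hv : Measurable v) {X : ℝ → Ω → Euc d} (hX : ∀ s, Measurable (X s)) (a : Euc d)
    {φ : ℝ × Euc d → ENNReal} (hφ : Measurable φ) {k : ℕ} (s : Fin (k + 1) → ℝ)
    (hlaw : Measure.map (fun ω (i : Fin (k + 1)) => X (s i) ω) (ℙ : Measure Ω) =
        (volume : Measure (Fin (k + 1) → Euc d)).withDensity
          (fun z => ENNReal.ofReal (jointDensity d a s z) *
            φ (s (Fin.last k), z (Fin.last k)))) :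
    ∫⁻ ω, ∏ i, ENNReal.ofReal (v (X (s i) ω)) =
      ∫⁻ z : Fin (k + 1) → Euc d, ENNReal.ofReal (jointDensity d a s z) *
        φ (s (Fin.last k), z (Fin.last k)) * ∏ i, ENNReal.ofReal (v (z i)) := by
  have hjd : Measurable fun z : Fin (k + 1) → Euc d => jointDensity d a s z :=
    measurable_jointDensity a s
  have hφ' : Measurable fun z : Fin (k + 1) → Euc d => φ (s (Fin.last k), z (Fin.last k)) :=
    hφ.comp (by fun_prop)
  have hprod : Measurable fun z : Fin (k + 1) → Euc d => ∏ i, ENNReal.ofReal (v (z i)) :=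
    Finset.measurable_prod _ fun i _ => (hv.comp (measurable_pi_apply i)).ennreal_ofReal
  have hdens : Measurable fun z : Fin (k + 1) → Euc d => ENNReal.ofReal (jointDensity d a s z) *
      φ (s (Fin.last k), z (Fin.last k)) := hjd.ennreal_ofReal.mul hφ'
  rw [← lintegral_map (f := fun z : Fin (k + 1) → Euc d => ∏ i, ENNReal.ofReal (v (z i)))
    (g := fun ω (i : Fin (k + 1)) => X (s i) ω) hprod (measurable_pi_iff.2 fun i => hX (s i)),
    hlaw, lintegral_withDensity_eq_lintegral_mul _ hdens hprod]
  rfl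

/-- Moment formula: the `k`-th moment of the occupation integral over `A` of a process whose
finite-dimensional laws are Brownian ones tilted by a function of the last point. -/
theorem lintegral_pow_occupation {Ω : Type*} [MeasureSpace Ω] [SFinite (ℙ : Measure Ω)]
    {d : ℕ} {v : Euc d → ℝ}
    (hv : Measurable v) {A : Set ℝ} (hA : MeasurableSet A) (hA0 : A ⊆ Set.Ioi 0)
    {X : ℝ → Ω → Euc d} (hX : Measurable (Function.uncurry X)) (a : Euc d)
    {φ : ℝ × Euc d → ENNReal} (hφ : Measurable φ)
    (hlaw : ∀ (k : ℕ) (s : Fin (k + 1) → ℝ), StrictMono s → (∀ i, s i ∈ A) →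
      Measure.map (fun ω (i : Fin (k + 1)) => X (s i) ω) (ℙ : Measure Ω) =
        (volume : Measure (Fin (k + 1) → Euc d)).withDensity
          (fun z => ENNReal.ofReal (jointDensity d a s z) * φ (s (Fin.last k), z (Fin.last k))))
    (k : ℕ) :
    ∫⁻ ω, (∫⁻ s in A, ENNReal.ofReal (v (X s ω))) ^ (k + 1) =
      ((k + 1).factorial : ENNReal) * (visitStep d v A (Set.Ioi 0))^[k + 1] φ (0, a) := by
  have hX' : ∀ s, Measurable (X s) := fun s => hX.comp measurable_prodMk_left
  have hA1 : Measurable (A.indicator (1 : ℝ → ENNReal)) := measurable_one.indicator hA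
  have hM1 : Measurable ({s : Fin (k + 1) → ℝ | StrictMono s}.indicator
      (1 : (Fin (k + 1) → ℝ) → ENNReal)) :=
    measurable_one.indicator (measurableSet_strictMono_fin _)
  have hf : ∀ ω, Measurable fun s => A.indicator 1 s * ENNReal.ofReal (v (X s ω)) := by
    intro ω
    exact hA1.mul (hv.comp (hX.comp (measurable_prodMk_right (y := ω)))).ennreal_ofReal
  have h1 : ∀ ω, (∫⁻ s in A, ENNReal.ofReal (v (X s ω))) ^ (k + 1) =
      ((k + 1).factorial : ENNReal) * ∫⁻ s : Fin (k + 1) → ℝ,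
        {s : Fin (k + 1) → ℝ | StrictMono s}.indicator 1 s * ((∏ i, A.indicator 1 (s i)) *
          ∏ i, ENNReal.ofReal (v (X (s i) ω))) := by
    intro ω
    rw [← lintegral_indicator hA]
    have : (A.indicator fun s => ENNReal.ofReal (v (X s ω))) =
        fun s => A.indicator 1 s * ENNReal.ofReal (v (X s ω)) := by
      ext s; by_cases hs : s ∈ A <;> simp [hs]
    rw [this, pow_lintegral_eq_factorial_mul (hf ω)]
    congr 1
    refine lintegral_congr fun s => ?_
    by_cases hs : StrictMono s <;> simp [hs, Finset.prod_mul_distrib]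
  have hmω : Measurable (Function.uncurry fun (ω : Ω) (s : Fin (k + 1) → ℝ) =>
        {s : Fin (k + 1) → ℝ | StrictMono s}.indicator (1 : (Fin (k + 1) → ℝ) → ENNReal) s *
          ((∏ i, A.indicator 1 (s i)) * ∏ i, ENNReal.ofReal (v (X (s i) ω)))) := by
    refine (hM1.comp measurable_snd).mul (Measurable.mul ?_ ?_)
    · refine Finset.measurable_prod _ fun i _ => hA1.comp (by fun_prop)
    · refine Finset.measurable_prod _ fun i _ => (hv.comp ?_).ennreal_ofReal
      exact hX.comp (by fun_prop : Measurable fun x : Ω × (Fin (k + 1) → ℝ) => (x.2 i, x.1))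
  simp only [h1]
  rw [lintegral_const_mul _ hmω.lintegral_prod_right, lintegral_lintegral_swap hmω.aemeasurable,
    visitStep_iterate_eq hv hA measurableSet_Ioi hφ]
  congr 1
  have hmp := volume_measurePreserving_arrowProdEquivProdArrow ℝ (Euc d) (Fin (k + 1))
  rw [← hmp.symm.lintegral_comp_emb (MeasurableEquiv.measurableEmbedding _),
    Measure.volume_eq_prod, lintegral_prod]
  · refine lintegral_congr fun s => ?_
    have hs1 : ∀ z : Fin (k + 1) → Euc d,
        (MeasurableEquiv.arrowProdEquivProdArrow ℝ (Euc d) (Fin (k + 1))).symm (s, z) =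
          fun i => (s i, z i) := fun z => rfl
    simp only [hs1, prod_visitKernel_eq v hA0]
    by_cases hs : StrictMono s
    swap
    · simp [hs]
    by_cases hsA : ∀ i, s i ∈ A
    swap
    · push Not at hsA
      obtain ⟨i, hi⟩ := hsA
      have h0 : ∏ i, A.indicator (1 : ℝ → ENNReal) (s i) = 0 :=
        Finset.prod_eq_zero (Finset.mem_univ i) (by simp [hi])
      simp [h0]
    have h3 := lintegral_prod_of_map_eq hv hX' a hφ s (hlaw k s hs hsA)
    simp only [Set.indicator_of_mem (show s ∈ {s : Fin (k + 1) → ℝ | StrictMono s} from hs),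
      Set.indicator_of_mem (hsA _), Pi.one_apply, Finset.prod_const_one, one_mul]
    rw [h3]
    refine lintegral_congr fun z => ?_
    simp only [← Fin.succ_last, Fin.cons_succ]
    ring
  · exact (measurable_prod_visitKernel hv hA measurableSet_Ioi hφ (by fun_prop)
      (by fun_prop)).aemeasurable

theorem visitKernel_mono {d : ℕ} {v : Euc d → ℝ} {A A' S S' : Set ℝ} (hA : A ⊆ A')
    (hS : S ⊆ S') (p q : ℝ × Euc d) : visitKernel d v A S p q ≤ visitKernel d v A' S' p q := by
  unfold visitKernel
  gcongr

theorem visitStep_mono {d : ℕ} {v : Euc d → ℝ} {A A' S S' : Set ℝ} (hA : A ⊆ A')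
    (hS : S ⊆ S') {φ ψ : ℝ × Euc d → ENNReal} (h : φ ≤ ψ) :
    visitStep d v A S φ ≤ visitStep d v A' S' ψ := by
  intro p
  exact lintegral_mono fun q => mul_le_mul' (visitKernel_mono hA hS p q) (h q)

theorem visitStep_iterate_mono {d : ℕ} {v : Euc d → ℝ} {A A' S S' : Set ℝ} (hA : A ⊆ A')
    (hS : S ⊆ S') {φ ψ : ℝ × Euc d → ENNReal} (h : φ ≤ ψ) (k : ℕ) :
    (visitStep d v A S)^[k] φ ≤ (visitStep d v A' S')^[k] ψ := by
  induction k with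
  | zero => exact h
  | succ k ih =>
    simp only [Function.iterate_succ_apply']
    exact visitStep_mono hA hS ih

theorem visitStep_iterate_add {d : ℕ} {v : Euc d → ℝ} (hv : Measurable v) {A S : Set ℝ}
    (hA : MeasurableSet A) (hS : MeasurableSet S) {φ ψ : ℝ × Euc d → ENNReal}
    (hφ : Measurable φ) (k : ℕ) :
    (visitStep d v A S)^[k] (fun q => φ q + ψ q) =
      fun p => (visitStep d v A S)^[k] φ p + (visitStep d v A S)^[k] ψ p := by
  induction k with
  | zero => rfl
  | succ k ih =>
    simp only [Function.iterate_succ_apply']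
    rw [ih]
    ext p
    simp only [visitStep, mul_add]
    rw [lintegral_add_left]
    exact (measurable_visitKernel_comp hv hA hS measurable_const measurable_id).mul
      (measurable_visitStep_iterate hv hA hS hφ k)

theorem visitStep_iterate_const_mul {d : ℕ} {v : Euc d → ℝ} {A S : Set ℝ}
    {c : ENNReal} (hc : c ≠ ⊤) (φ : ℝ × Euc d → ENNReal) (k : ℕ) :
    (visitStep d v A S)^[k] (fun q => c * φ q) =
      fun p => c * (visitStep d v A S)^[k] φ p := by
  induction k with
  | zero => rfl
  | succ k ih =>
    simp only [Function.iterate_succ_apply']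
    rw [ih]
    ext p
    simp only [visitStep]
    rw [← lintegral_const_mul' _ _ hc]
    exact lintegral_congr fun q => by ring

theorem visitStep_comm_iterate {d : ℕ} {v : Euc d → ℝ} (hv : Measurable v) {A S S' : Set ℝ}
    (hA : MeasurableSet A) (hS : MeasurableSet S) (hS' : MeasurableSet S')
    {Φ : ℝ × Euc d → ℝ × Euc d → ENNReal} (hΦ : Measurable (Function.uncurry Φ)) (l : ℕ)
    (p p' : ℝ × Euc d) :
    visitStep d v A S (fun q => (visitStep d v A S')^[l] (Φ q) p') p =
      (visitStep d v A S')^[l] (fun q' => visitStep d v A S (fun q => Φ q q') p) p' := by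
  induction l generalizing Φ with
  | zero => rfl
  | succ l ih =>
    simp only [Function.iterate_succ_apply]
    rw [ih (measurable_visitStep_param hv hA hS' hΦ)]
    refine congrArg (fun ψ => (visitStep d v A S')^[l] ψ p') (funext fun q' => ?_)
    simp only [visitStep]
    have h1 : ∀ q : ℝ × Euc d, visitKernel d v A S p q *
        ∫⁻ r, visitKernel d v A S' q' r * Φ q r =
        ∫⁻ r, visitKernel d v A S p q * (visitKernel d v A S' q' r * Φ q r) := fun q => by
      rw [lintegral_const_mul]
      exact (measurable_visitKernel_comp hv hA hS' measurable_const measurable_id).mul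
        (hΦ.comp measurable_prodMk_left)
    have h2 : ∀ r : ℝ × Euc d, visitKernel d v A S' q' r *
        ∫⁻ q, visitKernel d v A S p q * Φ q r =
        ∫⁻ q, visitKernel d v A S p q * (visitKernel d v A S' q' r * Φ q r) := fun r => by
      rw [← lintegral_const_mul]
      · exact lintegral_congr fun q => by ring
      · exact (measurable_visitKernel_comp hv hA hS measurable_const measurable_id).mul
          (hΦ.comp measurable_prodMk_right)
    simp only [h1, h2]
    refine lintegral_lintegral_swap (Measurable.aemeasurable ?_)
    refine Measurable.mul ?_ (Measurable.mul ?_ hΦ)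
    · exact measurable_visitKernel_comp hv hA hS measurable_const (by fun_prop)
    · exact measurable_visitKernel_comp hv hA hS' measurable_const (by fun_prop)

/-- The weight of the Brownian step joining a path started at `p` to a time-reversed path started
at `p'`, over the total time `t`; the duration of the step has to lie in `S`. -/
def gapWeight (d : ℕ) (S : Set ℝ) (t : ℝ) (p p' : ℝ × Euc d) : ENNReal :=
  S.indicator 1 (t - p.1 - p'.1) * ENNReal.ofReal (heatKernel d (t - p.1 - p'.1) (p'.2 - p.2))

theorem measurable_gapWeight (d : ℕ) {S : Set ℝ} (hS : MeasurableSet S) (t : ℝ) :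
    Measurable (Function.uncurry (gapWeight d S t)) := by
  have h2 : Measurable (S.indicator (1 : ℝ → ENNReal)) := measurable_one.indicator hS
  unfold gapWeight Function.uncurry
  fun_prop

theorem visitStep_gapWeight_comm {d : ℕ} {v : Euc d → ℝ} {A S S' : Set ℝ}
    {t : ℝ} (hAt : ∀ r, t - r ∈ A ↔ r ∈ A) (p p' : ℝ × Euc d) :
    visitStep d v A S (fun q => gapWeight d S' t q p') p =
      visitStep d v A S' (fun q => gapWeight d S t p q) p' := by
  have hmp : MeasurePreserving (fun q : ℝ × Euc d => (t - q.1, q.2)) volume volume :=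
    (Measure.measurePreserving_sub_left volume t).prod (MeasurePreserving.id volume)
  have hme : MeasurableEmbedding (fun q : ℝ × Euc d => (t - q.1, q.2)) := by
    refine (MeasurableEquiv.measurableEmbedding
      ((MeasurableEquiv.subLeft t).prodCongr (MeasurableEquiv.refl (Euc d))))
  simp only [visitStep]
  rw [← hmp.lintegral_comp_emb hme]
  refine lintegral_congr fun q => ?_
  have hA1 : A.indicator (1 : ℝ → ENNReal) (t - q.1) = A.indicator 1 q.1 := by
    by_cases h : q.1 ∈ A
    · rw [Set.indicator_of_mem h, Set.indicator_of_mem ((hAt _).2 h)]; rfl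
    · rw [Set.indicator_of_notMem h, Set.indicator_of_notMem (mt (hAt _).1 h)]
  simp only [visitKernel, gapWeight, hA1, sub_sub_cancel]
  rw [show t - q.1 - p.1 = t - p.1 - q.1 by ring, ← heatKernel_neg d _ (p'.2 - q.2), neg_sub]
  ring

theorem visitStep_iterate_eq_zero {d : ℕ} {v : Euc d → ℝ} {A : Set ℝ} {h : ℝ}
    {φ : ℝ × Euc d → ENNReal} (k : ℕ) (p : ℝ × Euc d)
    (hφ : ∀ q : ℝ × Euc d, q.1 ≤ p.1 + k * h → φ q = 0) :
    (visitStep d v A (Set.Ioo 0 h))^[k] φ p = 0 := by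
  induction k generalizing p with
  | zero => exact hφ p (by simp)
  | succ k ih =>
    rw [Function.iterate_succ_apply', visitStep]
    refine lintegral_eq_zero_of_ae_eq_zero (ae_of_all _ fun q => ?_)
    by_cases hq : q.1 - p.1 ∈ Set.Ioo 0 h
    · have : (visitStep d v A (Set.Ioo 0 h))^[k] φ q = 0 := by
        refine ih q fun r hr => hφ r (hr.trans ?_)
        push_cast
        have := hq.2
        linarith
      simp [this]
    · simp [visitKernel, hq]

/-- Decomposition of the bridge moment according to the last gap, counted from the end, of length
at least `t / (k + 1)`. -/
theorem visitStep_iterate_gapWeight_eq_sum {d : ℕ} {v : Euc d → ℝ} (hv : Measurable v) {A : Set ℝ}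
    (hA : MeasurableSet A) {t : ℝ} (ht : 0 < t) (hAt : ∀ r, t - r ∈ A ↔ r ∈ A) (a b : Euc d)
    (k : ℕ) :
    (visitStep d v A (Set.Ioi 0))^[k] (fun p => gapWeight d (Set.Ioi 0) t p (0, b)) (0, a) =
      ∑ l ∈ Finset.range (k + 1), (visitStep d v A (Set.Ioi 0))^[k - l] (fun p =>
        (visitStep d v A (Set.Ioo 0 (t / (k + 1))))^[l]
          (gapWeight d (Set.Ici (t / (k + 1))) t p) (0, b)) (0, a) := by
  set h : ℝ := t / (k + 1) with hh
  have hh0 : 0 < h := by positivity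
  let T : ℕ → ℕ → Set ℝ → ENNReal := fun j l S => (visitStep d v A (Set.Ioi 0))^[j] (fun p =>
        (visitStep d v A (Set.Ioo 0 h))^[l] (gapWeight d S t p) (0, b)) (0, a)
  have hTadd : ∀ j l, T j l (Set.Ioi 0) = T j l (Set.Ici h) + T j l (Set.Ioo 0 h) := by
    intro j l
    have h1 : ∀ p, gapWeight d (Set.Ioi 0) t p =
        fun q => gapWeight d (Set.Ici h) t p q + gapWeight d (Set.Ioo 0 h) t p q := by
      intro p
      ext q
      simp only [gapWeight]
      rw [← add_mul]
      congr 1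
      simp only [Set.indicator_apply, Set.mem_Ioi, Set.mem_Ici, Set.mem_Ioo, Pi.one_apply]
      by_cases h2 : h ≤ t - p.1 - q.1
      · simp [h2, not_lt.2 h2, hh0.trans_le h2]
      · simp [h2, not_le.1 h2]
    have h3 := visitStep_iterate_add hv hA measurableSet_Ioi (S := Set.Ioi 0)
      (φ := fun p => (visitStep d v A (Set.Ioo 0 h))^[l] (gapWeight d (Set.Ici h) t p) (0, b))
      (ψ := fun p => (visitStep d v A (Set.Ioo 0 h))^[l] (gapWeight d (Set.Ioo 0 h) t p) (0, b))
      ((measurable_visitStep_iterate_param hv hA measurableSet_Ioo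
        (measurable_gapWeight d measurableSet_Ici t) l).comp measurable_prodMk_right) j
    have h4 : ∀ p, (visitStep d v A (Set.Ioo 0 h))^[l] (gapWeight d (Set.Ioi 0) t p) (0, b) =
        (visitStep d v A (Set.Ioo 0 h))^[l] (gapWeight d (Set.Ici h) t p) (0, b) +
        (visitStep d v A (Set.Ioo 0 h))^[l] (gapWeight d (Set.Ioo 0 h) t p) (0, b) := by
      intro p
      rw [h1 p, visitStep_iterate_add hv hA measurableSet_Ioo
        (φ := gapWeight d (Set.Ici h) t p)
        ((measurable_gapWeight d measurableSet_Ici t).comp measurable_prodMk_left)]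
    simp only [T]
    rw [funext h4]
    exact congrFun h3 (0, a)
  have hTmove : ∀ j l, T (j + 1) l (Set.Ioo 0 h) = T j (l + 1) (Set.Ioi 0) := by
    intro j l
    simp only [T]
    rw [Function.iterate_succ_apply]
    refine congrArg (fun ψ => (visitStep d v A (Set.Ioi 0))^[j] ψ (0, a)) (funext fun p => ?_)
    rw [visitStep_comm_iterate hv hA measurableSet_Ioi measurableSet_Ioo
      (measurable_gapWeight d measurableSet_Ioo t), Function.iterate_succ_apply]
    refine congrArg (fun ψ => (visitStep d v A (Set.Ioo 0 h))^[l] ψ (0, b)) (funext fun p' => ?_)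
    exact visitStep_gapWeight_comm hAt p p'
  have hTend : T 0 k (Set.Ioo 0 h) = 0 := by
    refine visitStep_iterate_eq_zero k _ fun q hq => ?_
    have : t - 0 - q.1 ∉ Set.Ioo 0 h := by
      intro hmem
      have h1 := hmem.2
      have h2 : (k + 1 : ℝ) * h = t := by rw [hh]; field_simp
      simp only [zero_add] at hq
      linarith
    simp only [gapWeight]
    rw [Set.indicator_of_notMem this, zero_mul]
  have hind : ∀ m ≤ k, T k 0 (Set.Ioi 0) =
      ∑ l ∈ Finset.range m, T (k - l) l (Set.Ici h) + T (k - m) m (Set.Ioi 0) := by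
    intro m
    induction m with
    | zero => intro _; simp
    | succ m ih =>
      intro hm
      rw [ih (by omega), Finset.sum_range_succ, add_assoc, hTadd,
        show k - m = (k - (m + 1)) + 1 by omega, hTmove]
  have h5 := hind k le_rfl
  rw [hTadd (k - k) k, Nat.sub_self, hTend, add_zero] at h5
  rw [Finset.sum_range_succ, Nat.sub_self]
  exact h5

theorem visitStep_iterate_le {d : ℕ} {v : Euc d → ℝ} {A A' S S' : Set ℝ} (hA : A ⊆ A')
    (hS : S ⊆ S') {c : ENNReal} (hc : c ≠ ⊤) {φ : ℝ × Euc d → ENNReal}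
    (hφ : ∀ q, φ q ≤ c) (k : ℕ) (p : ℝ × Euc d) :
    (visitStep d v A S)^[k] φ p ≤ c * (visitStep d v A' S')^[k] (fun _ => 1) p := by
  have h1 := visitStep_iterate_mono (v := v) hA hS (φ := φ) (ψ := fun _ => c * 1)
    (fun q => by simpa using hφ q) k p
  rwa [visitStep_iterate_const_mul hc] at h1

theorem integral_heatKernel_le (d : ℕ) {s : ℝ} (hs : 0 < s) (w : Euc d) :
    ∫⁻ z, ENNReal.ofReal (heatKernel d s (z - w)) ≤ 1 := by
  rw [lintegral_sub_right_eq_self (fun z => ENNReal.ofReal (heatKernel d s z)) w]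
  have hb : 0 < 1 / (2 * s) := by positivity
  have h1 := GaussianFourier.integral_rexp_neg_mul_sq_norm (V := Euc d) hb
  have h2 : ∀ z : Euc d, heatKernel d s z =
      (2 * π * s) ^ (-(d : ℝ) / 2) * Real.exp (-(1 / (2 * s)) * ‖z‖ ^ 2) := by
    intro z; unfold heatKernel; congr 2; field_simp
  have hintegrable : Integrable fun z : Euc d => Real.exp (-(1 / (2 * s)) * ‖z‖ ^ 2) := by
    by_contra hni
    rw [integral_undef hni] at h1
    have : 0 < (π / (1 / (2 * s))) ^ ((Module.finrank ℝ (Euc d) : ℝ) / 2) := by positivity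
    linarith
  simp only [h2]
  rw [← ofReal_integral_eq_lintegral_ofReal (hintegrable.const_mul _)
    (ae_of_all _ fun z => by positivity), integral_const_mul, h1]
  refine ENNReal.ofReal_le_one.2 (le_of_eq ?_)
  rw [show π / (1 / (2 * s)) = 2 * π * s by field_simp, ← Real.rpow_add (by positivity)]
  simp [neg_div]

theorem heatKernel_le (d : ℕ) {s : ℝ} (hs : 0 < s) (w : Euc d) :
    heatKernel d s w ≤ (2 * π * s) ^ (-(d : ℝ) / 2) := by
  unfold heatKernel
  refine mul_le_of_le_one_right (by positivity) (Real.exp_le_one_iff.2 ?_)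
  have : 0 ≤ ‖w‖ ^ 2 / (2 * s) := by positivity
  rw [neg_div]; linarith

/-- In dimension at least three the expected occupation integral of a bounded function with
bounded support is bounded. -/
theorem exists_lintegral_visitKernel_le {d : ℕ} (hd : 3 ≤ d) {v : Euc d → ℝ}
    (hvb : ∃ C : ℝ, ∀ z, |v z| ≤ C) (hvs : ∃ R : ℝ, ∀ z, v z ≠ 0 → ‖z‖ ≤ R) :
    ∃ B : ENNReal, B ≠ ⊤ ∧ ∀ (A : Set ℝ) (p : ℝ × Euc d), MeasurableSet A →
      ∫⁻ q, visitKernel d v A (Set.Ioi 0) p q ≤ B := by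
  obtain ⟨C, hC⟩ := hvb
  obtain ⟨R, hR⟩ := hvs
  have hCv : ∀ z, ENNReal.ofReal (v z) ≤ ENNReal.ofReal C := fun z =>
    ENNReal.ofReal_le_ofReal ((le_abs_self _).trans (hC z))
  let V : ENNReal := volume (Metric.closedBall (0 : Euc d) R)
  have hV : V ≠ ⊤ := measure_closedBall_lt_top.ne
  let g : ℝ → ENNReal := fun u => (Set.Ioc (0 : ℝ) 1).indicator (fun _ => ENNReal.ofReal C) u +
    (Set.Ioi (1 : ℝ)).indicator (fun u => ENNReal.ofReal ((2 * π * u) ^ (-(d : ℝ) / 2)) *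
      (ENNReal.ofReal C * V)) u
  have hinner : ∀ (p : ℝ × Euc d) (r : ℝ), ∫⁻ z, (Set.Ioi (0 : ℝ)).indicator 1 (r - p.1) *
      (ENNReal.ofReal (heatKernel d (r - p.1) (z - p.2)) * ENNReal.ofReal (v z)) ≤
        g (r - p.1) := by
    intro p r
    by_cases h0 : 0 < r - p.1
    swap
    · simp [h0]
    simp only [Set.indicator_of_mem (Set.mem_Ioi.2 h0), Pi.one_apply, one_mul]
    by_cases h1 : r - p.1 ≤ 1
    · have : g (r - p.1) = ENNReal.ofReal C := by simp [g, h0, h1]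
      rw [this]
      calc _ ≤ ∫⁻ z, ENNReal.ofReal (heatKernel d (r - p.1) (z - p.2)) * ENNReal.ofReal C :=
            lintegral_mono fun z => by gcongr; exact (le_abs_self _).trans (hC z)
        _ ≤ 1 * ENNReal.ofReal C := by
            rw [lintegral_mul_const _ (by fun_prop)]
            gcongr
            exact integral_heatKernel_le d h0 _
        _ = _ := one_mul _
    · have : g (r - p.1) = ENNReal.ofReal ((2 * π * (r - p.1)) ^ (-(d : ℝ) / 2)) *
          (ENNReal.ofReal C * V) := by simp [g, h1, not_le.1 h1]
      rw [this]
      calc _ ≤ ∫⁻ z, ENNReal.ofReal ((2 * π * (r - p.1)) ^ (-(d : ℝ) / 2)) *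
            (Metric.closedBall (0 : Euc d) R).indicator (fun _ => ENNReal.ofReal C) z := by
            refine lintegral_mono fun z => ?_
            gcongr
            · exact heatKernel_le d h0 _
            · by_cases hz : v z = 0
              · simp [hz]
              · rw [Set.indicator_of_mem (by simpa using hR z hz)]
                exact hCv z
        _ = _ := by
            rw [lintegral_const_mul _ (measurable_const.indicator measurableSet_closedBall),
              lintegral_indicator measurableSet_closedBall, setLIntegral_const]
  refine ⟨∫⁻ u, g u, ?_, fun A p hA => ?_⟩
  · simp only [g]
    rw [lintegral_add_left (measurable_const.indicator measurableSet_Ioc),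
      lintegral_indicator measurableSet_Ioc, setLIntegral_const,
      lintegral_indicator measurableSet_Ioi, lintegral_mul_const _ (by fun_prop)]
    refine ENNReal.add_ne_top.2 ⟨ENNReal.mul_ne_top ENNReal.ofReal_ne_top (by simp),
      ENNReal.mul_ne_top ?_ (ENNReal.mul_ne_top ENNReal.ofReal_ne_top hV)⟩
    have hd' : (3 : ℝ) ≤ d := by exact_mod_cast hd
    have hi : IntegrableOn (fun u : ℝ => (2 * π * u) ^ (-(d : ℝ) / 2)) (Set.Ioi 1) := by
      have h1 : IntegrableOn (fun u : ℝ => (2 * π) ^ (-(d : ℝ) / 2) * u ^ (-(d : ℝ) / 2))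
          (Set.Ioi 1) :=
        (integrableOn_Ioi_rpow_of_lt (by linarith) one_pos).const_mul _
      refine h1.congr_fun (fun u hu => ?_) measurableSet_Ioi
      have : (0 : ℝ) ≤ u := zero_le_one.trans (le_of_lt hu)
      exact (Real.mul_rpow (by positivity) this).symm
    exact hi.lintegral_lt_top.ne
  · calc ∫⁻ q, visitKernel d v A (Set.Ioi 0) p q
        ≤ ∫⁻ q : ℝ × Euc d, (Set.Ioi (0 : ℝ)).indicator 1 (q.1 - p.1) *
          (ENNReal.ofReal (heatKernel d (q.1 - p.1) (q.2 - p.2)) * ENNReal.ofReal (v q.2)) := by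
          refine lintegral_mono fun q => ?_
          unfold visitKernel
          refine mul_le_of_le_one_left (zero_le) ?_
          exact Set.indicator_apply_le' (fun _ => le_rfl) (fun _ => zero_le)
      _ ≤ ∫⁻ r, ∫⁻ z, (Set.Ioi (0 : ℝ)).indicator 1 (r - p.1) *
          (ENNReal.ofReal (heatKernel d (r - p.1) (z - p.2)) * ENNReal.ofReal (v z)) := by
          rw [Measure.volume_eq_prod]
          exact lintegral_prod_le _
      _ ≤ ∫⁻ r, g (r - p.1) := lintegral_mono fun r => hinner p r
      _ = ∫⁻ u, g u := lintegral_sub_right_eq_self g p.1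

theorem heatKernel_sub_le {d : ℕ} {R ε s : ℝ} (hε : 0 < ε) (hs : ε < s) {a x z : Euc d}
    (hz : ‖z‖ ≤ R) (hax : ‖a - x‖ ≤ 1) :
    heatKernel d s (z - a) ≤
      Real.exp ((2 * R + 2 * ‖x‖ + 1) / (2 * ε)) * heatKernel d s (z - x) := by
  have hs0 : 0 < s := hε.trans hs
  have h1 : ‖z - x‖ ≤ ‖z - a‖ + ‖a - x‖ := norm_sub_le_norm_sub_add_norm_sub z a x
  have h2 : ‖z - x‖ ≤ ‖z‖ + ‖x‖ := norm_sub_le z x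
  have h3 : ‖z - a‖ ≤ ‖z - x‖ + ‖a - x‖ := by
    rw [norm_sub_rev a x]; exact norm_sub_le_norm_sub_add_norm_sub z x a
  have h4 : ‖z - x‖ ^ 2 - ‖z - a‖ ^ 2 ≤ 2 * R + 2 * ‖x‖ + 1 := by
    nlinarith [norm_nonneg (z - x), norm_nonneg (z - a)]
  have hD : 0 ≤ 2 * R + 2 * ‖x‖ + 1 := by
    have := (norm_nonneg z).trans hz
    positivity
  unfold heatKernel
  rw [mul_left_comm, ← Real.exp_add]
  gcongr
  have h5 : (2 * R + 2 * ‖x‖ + 1) / (2 * s) ≤ (2 * R + 2 * ‖x‖ + 1) / (2 * ε) := by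
    gcongr
  have h6 : (‖z - x‖ ^ 2 - ‖z - a‖ ^ 2) / (2 * s) ≤ (2 * R + 2 * ‖x‖ + 1) / (2 * s) := by
    gcongr
  rw [sub_div] at h6
  rw [neg_div, neg_div]
  linarith

/-- Moving the spatial starting point of the visit kernel by a bounded amount costs a bounded
factor, if the visited times are bounded away from zero. -/
theorem visitKernel_start_le {d : ℕ} {v : Euc d → ℝ} {R ε : ℝ} (hvs : ∀ z, v z ≠ 0 → ‖z‖ ≤ R)
    (hε : 0 < ε) {A : Set ℝ} (hA : A ⊆ Set.Ioi ε) (S : Set ℝ) {a x : Euc d} (hax : ‖a - x‖ ≤ 1)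
    (q : ℝ × Euc d) :
    visitKernel d v A S (0, a) q ≤
      ENNReal.ofReal (Real.exp ((2 * R + 2 * ‖x‖ + 1) / (2 * ε))) *
        visitKernel d v A S (0, x) q := by
  by_cases hq : q.1 ∈ A
  swap
  · simp [visitKernel, hq]
  by_cases hv : v q.2 = 0
  · simp [visitKernel, hv]
  have h := heatKernel_sub_le hε (hA hq) (hvs _ hv) hax
  simp only [visitKernel, sub_zero]
  calc _ ≤ A.indicator 1 q.1 * (S.indicator 1 q.1 * (ENNReal.ofReal
        (Real.exp ((2 * R + 2 * ‖x‖ + 1) / (2 * ε)) * heatKernel d q.1 (q.2 - x)) *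
          ENNReal.ofReal (v q.2))) := by gcongr
    _ = _ := by rw [ENNReal.ofReal_mul (Real.exp_pos _).le]; ring

theorem exists_visitStep_start_le {d : ℕ} {v : Euc d → ℝ} (hvs : ∃ R : ℝ, ∀ z, v z ≠ 0 → ‖z‖ ≤ R)
    {ε : ℝ} (hε : 0 < ε) (x : Euc d) :
    ∃ D : ENNReal, D ≠ ⊤ ∧ 1 ≤ D ∧
      (∀ a, ‖a - x‖ ≤ 1 → ∀ A ⊆ Set.Ioi ε, ∀ S q,
        visitKernel d v A S (0, a) q ≤ D * visitKernel d v A S (0, x) q) ∧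
      ∀ a, ‖a - x‖ ≤ 1 → ∀ k, (visitStep d v (Set.Ioi ε) (Set.Ioi 0))^[k] (fun _ => 1) (0, a) ≤
        D * (visitStep d v (Set.Ioi ε) (Set.Ioi 0))^[k] (fun _ => 1) (0, x) := by
  obtain ⟨R, hR⟩ := hvs
  have hmain : ∀ a, ‖a - x‖ ≤ 1 → ∀ A ⊆ Set.Ioi ε, ∀ S q, visitKernel d v A S (0, a) q ≤
      max 1 (ENNReal.ofReal (Real.exp ((2 * R + 2 * ‖x‖ + 1) / (2 * ε)))) *
        visitKernel d v A S (0, x) q := fun a ha A hA S q =>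
    (visitKernel_start_le hR hε hA S ha q).trans (by gcongr; exact le_max_right _ _)
  refine ⟨_, max_ne_top ENNReal.one_ne_top ENNReal.ofReal_ne_top, le_max_left _ _, hmain,
    fun a ha k => ?_⟩
  set D := max 1 (ENNReal.ofReal (Real.exp ((2 * R + 2 * ‖x‖ + 1) / (2 * ε))))
  have hDtop : D ≠ ⊤ := max_ne_top ENNReal.one_ne_top ENNReal.ofReal_ne_top
  cases k with
  | zero => simp [D]
  | succ k =>
    simp only [Function.iterate_succ_apply', visitStep]
    rw [← lintegral_const_mul' _ _ hDtop]
    refine lintegral_mono fun q => ?_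
    rw [← mul_assoc]
    gcongr
    exact hmain a ha _ subset_rfl _ _

theorem visitKernel_ne_top (d : ℕ) (v : Euc d → ℝ) (A S : Set ℝ) (p q : ℝ × Euc d) :
    visitKernel d v A S p q ≠ ⊤ := by
  have h : ∀ (B : Set ℝ) (r : ℝ), B.indicator (1 : ℝ → ENNReal) r ≠ ⊤ := by
    intro B r
    by_cases hr : r ∈ B <;> simp [hr]
  exact ENNReal.mul_ne_top (h _ _) (ENNReal.mul_ne_top (h _ _)
    (ENNReal.mul_ne_top ENNReal.ofReal_ne_top ENNReal.ofReal_ne_top))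

theorem visitStep_iterate_one_le {d : ℕ} {v : Euc d → ℝ} {A S : Set ℝ} {B : ENNReal}
    (hB : ∀ p, ∫⁻ q, visitKernel d v A S p q ≤ B) (hBtop : B ≠ ⊤) (k : ℕ) (p : ℝ × Euc d) :
    (visitStep d v A S)^[k] (fun _ => 1) p ≤ B ^ k := by
  induction k generalizing p with
  | zero => simp
  | succ k ih =>
    rw [Function.iterate_succ_apply', visitStep]
    calc _ ≤ ∫⁻ q, visitKernel d v A S p q * B ^ k := lintegral_mono fun q => by gcongr; exact ih q
      _ = (∫⁻ q, visitKernel d v A S p q) * B ^ k :=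
          lintegral_mul_const' _ _ (ENNReal.pow_ne_top hBtop)
      _ ≤ B * B ^ k := by gcongr; exact hB p
      _ = B ^ (k + 1) := (pow_succ' _ _).symm

theorem eventually_visitKernel_eq {ι : Type*} {f : Filter ι} {d : ℕ} {v : Euc d → ℝ}
    {A S : ι → Set ℝ} {A₀ S₀ : Set ℝ}
    (hA : ∀ t, A t ⊆ A₀) (hA' : ∀ r ∈ A₀, ∀ᶠ t in f, r ∈ A t)
    (hS : ∀ t, S t ⊆ S₀) (hS' : ∀ r ∈ S₀, ∀ᶠ t in f, r ∈ S t) (r₀ : ℝ) (q : ℝ × Euc d) :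
    ∀ᶠ t in f, ∀ a, visitKernel d v (A t) (S t) (r₀, a) q = visitKernel d v A₀ S₀ (r₀, a) q := by
  have h : ∀ {B : ι → Set ℝ} {B₀ : Set ℝ}, (∀ t, B t ⊆ B₀) → (∀ r ∈ B₀, ∀ᶠ t in f, r ∈ B t) →
      ∀ r, ∀ᶠ t in f, (B t).indicator (1 : ℝ → ENNReal) r = B₀.indicator 1 r := by
    intro B B₀ h1 h2 r
    by_cases hr : r ∈ B₀
    · filter_upwards [h2 r hr] with t ht
      simp [hr, ht]
    · exact Eventually.of_forall fun t => by
        rw [Set.indicator_of_notMem hr, Set.indicator_of_notMem fun h3 => hr (h1 t h3)]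
  filter_upwards [h hA hA' q.1, h hS hS' (q.1 - r₀)] with t h1 h2 a
  simp only [visitKernel, h1, h2]

/-- Dominated convergence for iterates of visit operators, with a fixed starting point. -/
theorem tendsto_visitStep_iterate {ι : Type*} {f : Filter ι} [f.IsCountablyGenerated] {d : ℕ}
    {v : Euc d → ℝ} (hv : Measurable v) {A S : ι → Set ℝ} {A₀ S₀ : Set ℝ}
    (hAm : ∀ t, MeasurableSet (A t)) (hSm : ∀ t, MeasurableSet (S t))
    (hA : ∀ t, A t ⊆ A₀) (hA' : ∀ r ∈ A₀, ∀ᶠ t in f, r ∈ A t)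
    (hS : ∀ t, S t ⊆ S₀) (hS' : ∀ r ∈ S₀, ∀ᶠ t in f, r ∈ S t)
    {B : ENNReal} (hB : ∀ p, ∫⁻ q, visitKernel d v A₀ S₀ p q ≤ B) (hBtop : B ≠ ⊤)
    {Φ : ι → ℝ × Euc d → ENNReal} {Φ₀ : ℝ × Euc d → ENNReal} (hΦm : ∀ t, Measurable (Φ t))
    {c : ENNReal} (hc : c ≠ ⊤) (hΦc : ∀ᶠ t in f, ∀ q, Φ t q ≤ c)
    (hΦ : ∀ q, Tendsto (fun t => Φ t q) f (𝓝 (Φ₀ q))) (k : ℕ) (p : ℝ × Euc d) :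
    Tendsto (fun t => (visitStep d v (A t) (S t))^[k] (Φ t) p) f
      (𝓝 ((visitStep d v A₀ S₀)^[k] Φ₀ p)) := by
  induction k generalizing p with
  | zero => exact hΦ p
  | succ k ih =>
    simp only [Function.iterate_succ_apply']
    unfold visitStep at ih ⊢
    refine tendsto_lintegral_filter_of_dominated_convergence
      (fun q => visitKernel d v A₀ S₀ p q * (c * B ^ k)) ?_ ?_ ?_ ?_
    · exact Eventually.of_forall fun t =>
        (measurable_visitKernel_comp hv (hAm t) (hSm t) measurable_const measurable_id).mul
          (measurable_visitStep_iterate hv (hAm t) (hSm t) (hΦm t) k)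
    · filter_upwards [hΦc] with t ht
      refine ae_of_all _ fun q => mul_le_mul' (visitKernel_mono (hA t) (hS t) p q) ?_
      refine (visitStep_iterate_le (hA t) (hS t) hc ht k q).trans ?_
      gcongr
      exact visitStep_iterate_one_le hB hBtop k q
    · have htop : c * B ^ k ≠ ⊤ := ENNReal.mul_ne_top hc (ENNReal.pow_ne_top hBtop)
      rw [lintegral_mul_const' _ _ htop]
      exact ENNReal.mul_ne_top (ne_top_of_le_ne_top hBtop (hB p)) htop
    · refine ae_of_all _ fun q => ?_
      refine (ENNReal.Tendsto.const_mul (ih q)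
        (Or.inr (visitKernel_ne_top d v A₀ S₀ p q))).congr' ?_
      filter_upwards [eventually_visitKernel_eq (v := v) hA hA' hS hS' p.1 q] with t ht
      rw [show p = (p.1, p.2) from rfl, ht p.2]

/-- Dominated convergence for iterates of visit operators, with a convergent starting point. -/
theorem tendsto_visitStep_iterate_start {ι : Type*} {f : Filter ι} [f.NeBot]
    [f.IsCountablyGenerated] {d : ℕ} {v : Euc d → ℝ} (hv : Measurable v)
    (hvs : ∃ R : ℝ, ∀ z, v z ≠ 0 → ‖z‖ ≤ R)
    {ε : ℝ} (hε : 0 < ε) {A S : ι → Set ℝ} {S₀ : Set ℝ}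
    (hAm : ∀ t, MeasurableSet (A t)) (hSm : ∀ t, MeasurableSet (S t))
    (hA : ∀ t, A t ⊆ Set.Ioi ε) (hA' : ∀ r ∈ Set.Ioi ε, ∀ᶠ t in f, r ∈ A t)
    (hS : ∀ t, S t ⊆ S₀) (hS' : ∀ r ∈ S₀, ∀ᶠ t in f, r ∈ S t)
    {B : ENNReal} (hB : ∀ p, ∫⁻ q, visitKernel d v (Set.Ioi ε) S₀ p q ≤ B) (hBtop : B ≠ ⊤)
    {Φ : ι → ℝ × Euc d → ENNReal} {Φ₀ : ℝ × Euc d → ENNReal} (hΦm : ∀ t, Measurable (Φ t))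
    {c : ENNReal} (hc : c ≠ ⊤) (hΦc : ∀ᶠ t in f, ∀ q, Φ t q ≤ c)
    (hΦ : ∀ q, Tendsto (fun t => Φ t q) f (𝓝 (Φ₀ q))) {a : ι → Euc d} {x : Euc d}
    (ha : Tendsto a f (𝓝 x)) (hΦa : Tendsto (fun t => Φ t (0, a t)) f (𝓝 (Φ₀ (0, x)))) (k : ℕ) :
    Tendsto (fun t => (visitStep d v (A t) (S t))^[k] (Φ t) (0, a t)) f
      (𝓝 ((visitStep d v (Set.Ioi ε) S₀)^[k] Φ₀ (0, x))) := by
  cases k with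
  | zero => exact hΦa
  | succ k =>
    obtain ⟨D, hDtop, -, hD, -⟩ := exists_visitStep_start_le hvs hε x
    have hax : ∀ᶠ t in f, ‖a t - x‖ ≤ 1 := by
      have := ha.eventually (Metric.closedBall_mem_nhds x one_pos)
      simpa [dist_eq_norm] using this
    have ih := tendsto_visitStep_iterate hv hAm hSm hA hA' hS hS' hB hBtop hΦm hc hΦc hΦ k
    simp only [Function.iterate_succ_apply']
    unfold visitStep at ih ⊢
    refine tendsto_lintegral_filter_of_dominated_convergence
      (fun q => D * visitKernel d v (Set.Ioi ε) S₀ (0, x) q * (c * B ^ k)) ?_ ?_ ?_ ?_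
    · exact Eventually.of_forall fun t =>
        (measurable_visitKernel_comp hv (hAm t) (hSm t) measurable_const measurable_id).mul
          (measurable_visitStep_iterate hv (hAm t) (hSm t) (hΦm t) k)
    · filter_upwards [hΦc, hax] with t ht htx
      refine ae_of_all _ fun q => mul_le_mul' ((visitKernel_mono (hA t) (hS t) _ q).trans
        (hD _ htx _ subset_rfl _ _)) ?_
      refine (visitStep_iterate_le (hA t) (hS t) hc ht k q).trans ?_
      gcongr
      exact visitStep_iterate_one_le hB hBtop k q
    · have htop : c * B ^ k ≠ ⊤ := ENNReal.mul_ne_top hc (ENNReal.pow_ne_top hBtop)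
      rw [lintegral_mul_const' _ _ htop, lintegral_const_mul' _ _ hDtop]
      exact ENNReal.mul_ne_top (ENNReal.mul_ne_top hDtop
        (ne_top_of_le_ne_top hBtop (hB _))) htop
    · refine ae_of_all _ fun q => ?_
      refine Tendsto.congr' ?_ (ENNReal.Tendsto.mul
        (ma := fun t => visitKernel d v (Set.Ioi ε) S₀ (0, a t) q) ?_ (Or.inr ?_) (ih q)
        (Or.inr (visitKernel_ne_top d v (Set.Ioi ε) S₀ (0, x) q)))
      · filter_upwards [eventually_visitKernel_eq (v := v) hA hA' hS hS' 0 q] with t ht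
        rw [ht]
      · have hcont : Continuous fun w : Euc d => heatKernel d (q.1 - 0) (q.2 - w) := by
          unfold heatKernel
          fun_prop
        have h1 := ENNReal.tendsto_ofReal ((hcont.tendsto x).comp ha)
        have hi : ∀ (B : Set ℝ) (r : ℝ), B.indicator (1 : ℝ → ENNReal) r ≠ ⊤ := by
          intro B r
          by_cases hr : r ∈ B <;> simp [hr]
        unfold visitKernel
        exact ENNReal.Tendsto.const_mul (ENNReal.Tendsto.const_mul
          (ENNReal.Tendsto.mul_const h1 (Or.inr ENNReal.ofReal_ne_top)) (Or.inr (hi _ _)))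
          (Or.inr (hi _ _))
      · refine ne_top_of_le_ne_top (ENNReal.mul_ne_top hc (ENNReal.pow_ne_top hBtop (n := k)))
          (le_of_tendsto (ih q) ?_)
        filter_upwards [hΦc] with t ht
        refine (visitStep_iterate_le (hA t) (hS t) hc ht k q).trans ?_
        gcongr
        exact visitStep_iterate_one_le hB hBtop k q

/-- The gap weight normalised by the bridge density converges to one. -/
theorem tendsto_gapWeight_div (d : ℕ) {n : ℕ} (hn : 1 ≤ n) {p p' : ℝ → ℝ × Euc d}
    {p₀ p₀' : ℝ × Euc d} (hp : Tendsto p atTop (𝓝 p₀)) (hp' : Tendsto p' atTop (𝓝 p₀'))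
    {u : ℝ → Euc d} {u₀ : Euc d} (hu : Tendsto u atTop (𝓝 u₀)) :
    Tendsto (fun t : ℝ => ENNReal.ofReal (heatKernel d t (u t))⁻¹ *
      gapWeight d (Set.Ici (t / (n + 1))) t (p t) (p' t)) atTop (𝓝 1) := by
  have hr : Tendsto (fun t => (p t).1 + (p' t).1) atTop (𝓝 (p₀.1 + p₀'.1)) :=
    ((continuous_fst.tendsto _).comp hp).add ((continuous_fst.tendsto _).comp hp')
  have hw : Tendsto (fun t => (p' t).2 - (p t).2) atTop (𝓝 (p₀'.2 - p₀.2)) :=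
    ((continuous_snd.tendsto _).comp hp').sub ((continuous_snd.tendsto _).comp hp)
  have hrt : Tendsto (fun t => ((p t).1 + (p' t).1) / t) atTop (𝓝 0) := hr.div_atTop tendsto_id
  have hone : Tendsto (fun t => 1 - ((p t).1 + (p' t).1) / t) atTop (𝓝 1) := by
    simpa using hrt.const_sub 1
  have hτ : Tendsto (fun t => 2 * (t - ((p t).1 + (p' t).1))) atTop atTop := by
    refine Tendsto.const_mul_atTop two_pos ?_
    simpa [sub_eq_add_neg] using tendsto_id.atTop_add hr.neg
  have h2t : Tendsto (fun t : ℝ => 2 * t) atTop atTop :=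
    Tendsto.const_mul_atTop two_pos tendsto_id
  have hmain : Tendsto (fun t => (1 - ((p t).1 + (p' t).1) / t) ^ (-(d : ℝ) / 2) *
      Real.exp (-‖(p' t).2 - (p t).2‖ ^ 2 / (2 * (t - ((p t).1 + (p' t).1))) +
        ‖u t‖ ^ 2 / (2 * t))) atTop (𝓝 1) := by
    have h1 := hone.rpow_const (p := -(d : ℝ) / 2) (Or.inl one_ne_zero)
    have h2 : Tendsto (fun t => -‖(p' t).2 - (p t).2‖ ^ 2 / (2 * (t - ((p t).1 + (p' t).1))) +
        ‖u t‖ ^ 2 / (2 * t)) atTop (𝓝 0) := by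
      simpa using ((hw.norm.pow 2).neg.div_atTop hτ).add ((hu.norm.pow 2).div_atTop h2t)
    simpa using h1.mul ((Real.continuous_exp.tendsto 0).comp h2)
  have hfinal := ENNReal.tendsto_ofReal hmain
  rw [ENNReal.ofReal_one] at hfinal
  refine hfinal.congr' ?_
  have hlt : ((1 : ℝ) / (n + 1)) < 1 := by
    rw [div_lt_one (by positivity)]
    have : (1 : ℝ) ≤ n := by exact_mod_cast hn
    linarith
  filter_upwards [hone.eventually (lt_mem_nhds hlt), eventually_gt_atTop 0] with t ht1 ht0
  have h1 : t / (n + 1) ≤ t - (p t).1 - (p' t).1 := by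
    have := mul_le_mul_of_nonneg_left ht1.le ht0.le
    rw [mul_sub, mul_div_cancel₀ _ ht0.ne'] at this
    rw [← mul_one_div]
    linarith
  have hτ0 : 0 < t - ((p t).1 + (p' t).1) := by
    have : 0 < t / (n + 1) := by positivity
    linarith
  rw [gapWeight, Set.indicator_of_mem (Set.mem_Ici.2 h1), Pi.one_apply, one_mul,
    ← ENNReal.ofReal_mul (inv_nonneg.2 (heatKernel_nonneg d ht0.le _)), sub_sub]
  congr 1
  unfold heatKernel
  have hne : (2 * π * t) ^ (-(d : ℝ) / 2) ≠ 0 := by positivity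
  have h2 : (2 * π * (t - ((p t).1 + (p' t).1))) ^ (-(d : ℝ) / 2) =
      (2 * π * t) ^ (-(d : ℝ) / 2) * (1 - ((p t).1 + (p' t).1) / t) ^ (-(d : ℝ) / 2) := by
    rw [← Real.mul_rpow (by positivity) (by rw [one_sub_div ht0.ne']; positivity)]
    congr 1
    field_simp
  rw [h2, Real.exp_add, neg_div (2 * t) (‖u t‖ ^ 2), Real.exp_neg (‖u t‖ ^ 2 / (2 * t)), mul_inv,
    inv_inv]
  field_simp

theorem gapWeight_div_le (d n : ℕ) {t : ℝ} (ht : 0 < t) (u : Euc d) (hu : ‖u‖ ^ 2 ≤ 2 * t)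
    (p p' : ℝ × Euc d) :
    ENNReal.ofReal (heatKernel d t u)⁻¹ * gapWeight d (Set.Ici (t / (n + 1))) t p p' ≤
      ENNReal.ofReal (Real.exp 1 * (n + 1 : ℝ) ^ ((d : ℝ) / 2)) := by
  by_cases h : t / (n + 1) ≤ t - p.1 - p'.1
  swap
  · simp [gapWeight, h]
  have h0 : 0 < t / (n + 1) := by positivity
  rw [gapWeight, Set.indicator_of_mem (Set.mem_Ici.2 h), Pi.one_apply, one_mul,
    ← ENNReal.ofReal_mul (inv_nonneg.2 (heatKernel_nonneg d ht.le _))]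
  refine ENNReal.ofReal_le_ofReal ?_
  have h1 : heatKernel d (t - p.1 - p'.1) (p'.2 - p.2) ≤
      (2 * π * t) ^ (-(d : ℝ) / 2) * (n + 1 : ℝ) ^ ((d : ℝ) / 2) := by
    refine (heatKernel_le d (h0.trans_le h) _).trans ?_
    calc (2 * π * (t - p.1 - p'.1)) ^ (-(d : ℝ) / 2)
        ≤ (2 * π * (t / (n + 1))) ^ (-(d : ℝ) / 2) := by
          refine Real.rpow_le_rpow_of_nonpos (by positivity) (by gcongr) ?_
          rw [neg_div]; simp; positivity
      _ = _ := by
          rw [← mul_div_assoc, Real.div_rpow (by positivity) (by positivity), div_eq_mul_inv,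
            ← Real.rpow_neg (by positivity), neg_div, neg_neg]
  have h2 : Real.exp (-1) ≤ Real.exp (-‖u‖ ^ 2 / (2 * t)) := by
    refine Real.exp_le_exp.2 ?_
    rw [neg_div, neg_le_neg_iff, div_le_one (by positivity)]
    exact hu
  have h3 : (2 * π * t) ^ (-(d : ℝ) / 2) * Real.exp (-1) ≤ heatKernel d t u := by
    unfold heatKernel; gcongr
  rw [inv_mul_le_iff₀ (heatKernel_pos d ht u)]
  refine h1.trans ?_
  calc _ = ((2 * π * t) ^ (-(d : ℝ) / 2) * Real.exp (-1)) *
        (Real.exp 1 * (n + 1 : ℝ) ^ ((d : ℝ) / 2)) := by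
        rw [Real.exp_neg]; field_simp
    _ ≤ _ := by gcongr

/-- The `k`-th moment of the occupation integral over the times after `ε`, divided by `k!`, for
Brownian motion started at `x`. -/
def occupationMoment (d : ℕ) (v : Euc d → ℝ) (ε : ℝ) (k : ℕ) (x : Euc d) : ENNReal :=
  (visitStep d v (Set.Ioi ε) (Set.Ioi 0))^[k] (fun _ => 1) (0, x)

/-- The analogue of `occupationMoment` for a Brownian bridge from `a` to `b` in time `t`, where
the visits take place at times in `(ε, t - ε)`. -/
def bridgeOccupationMoment (d : ℕ) (v : Euc d → ℝ) (ε t : ℝ) (k : ℕ) (a b : Euc d) : ENNReal :=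
  (visitStep d v (Set.Ioo ε (t - ε)) (Set.Ioi 0))^[k]
    (fun p => ENNReal.ofReal (heatKernel d t (b - a))⁻¹ * gapWeight d (Set.Ioi 0) t p (0, b))
    (0, a)

theorem bridgeOccupationMoment_eq_sum {d : ℕ} {v : Euc d → ℝ} (hv : Measurable v) {ε t : ℝ}
    (ht : 0 < t) (a b : Euc d) (k : ℕ) :
    bridgeOccupationMoment d v ε t k a b = ∑ l ∈ Finset.range (k + 1),
      (visitStep d v (Set.Ioo ε (t - ε)) (Set.Ioi 0))^[k - l] (fun p =>
        (visitStep d v (Set.Ioo ε (t - ε)) (Set.Ioo 0 (t / (k + 1))))^[l]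
          (fun q => ENNReal.ofReal (heatKernel d t (b - a))⁻¹ *
            gapWeight d (Set.Ici (t / (k + 1))) t p q) (0, b)) (0, a) := by
  have hAt : ∀ r, t - r ∈ Set.Ioo ε (t - ε) ↔ r ∈ Set.Ioo ε (t - ε) := by
    intro r
    simp only [Set.mem_Ioo]
    constructor <;> rintro ⟨h1, h2⟩ <;> constructor <;> linarith
  rw [bridgeOccupationMoment, visitStep_iterate_const_mul ENNReal.ofReal_ne_top]
  beta_reduce
  rw [visitStep_iterate_gapWeight_eq_sum hv measurableSet_Ioo ht hAt, Finset.mul_sum]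
  simp only [visitStep_iterate_const_mul ENNReal.ofReal_ne_top]

theorem eventually_norm_sub_sq_le {d : ℕ} {a b : ℝ → Euc d} {x y : Euc d}
    (ha : Tendsto a atTop (𝓝 x)) (hb : Tendsto b atTop (𝓝 y)) :
    ∀ᶠ t : ℝ in atTop, ‖b t - a t‖ ^ 2 ≤ 2 * t := by
  have h1 : ∀ᶠ t in atTop, ‖b t - a t‖ ^ 2 < ‖y - x‖ ^ 2 + 1 :=
    ((hb.sub ha).norm.pow 2).eventually (gt_mem_nhds (lt_add_one _))
  filter_upwards [h1, eventually_ge_atTop ((‖y - x‖ ^ 2 + 1) / 2)] with t ht1 ht2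
  linarith

theorem occupationMoment_ne_top {d : ℕ} (hd : 3 ≤ d) {v : Euc d → ℝ}
    (hvb : ∃ C : ℝ, ∀ z, |v z| ≤ C) (hvs : ∃ R : ℝ, ∀ z, v z ≠ 0 → ‖z‖ ≤ R) (ε : ℝ) (k : ℕ)
    (x : Euc d) : occupationMoment d v ε k x ≠ ⊤ := by
  obtain ⟨B, hBtop, hB⟩ := exists_lintegral_visitKernel_le hd hvb hvs
  exact ne_top_of_le_ne_top (ENNReal.pow_ne_top hBtop)
    (visitStep_iterate_one_le (fun p => hB (Set.Ioi ε) p measurableSet_Ioi) hBtop k _)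

theorem exists_bridgeOccupationMoment_le {d : ℕ} (hd : 3 ≤ d) {v : Euc d → ℝ}
    (hv : Measurable v) (hvb : ∃ C : ℝ, ∀ z, |v z| ≤ C)
    (hvs : ∃ R : ℝ, ∀ z, v z ≠ 0 → ‖z‖ ≤ R) {ε : ℝ} (hε : 0 < ε)
    {a b : ℝ → Euc d} {x y : Euc d}
    (ha : Tendsto a atTop (𝓝 x)) (hb : Tendsto b atTop (𝓝 y)) :
    ∃ D : ENNReal, D ≠ ⊤ ∧ ∀ᶠ t in atTop, ∀ k : ℕ, bridgeOccupationMoment d v ε t k (a t) (b t) ≤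
      D * ENNReal.ofReal ((k + 1 : ℝ) ^ ((d : ℝ) / 2)) * ∑ l ∈ Finset.range (k + 1),
        occupationMoment d v ε (k - l) x * occupationMoment d v ε l y := by
  obtain ⟨D, hDtop, -, -, hD⟩ := exists_visitStep_start_le hvs hε x
  obtain ⟨D', hDtop', -, -, hD'⟩ := exists_visitStep_start_le hvs hε y
  refine ⟨ENNReal.ofReal (Real.exp 1) * D * D', by finiteness, ?_⟩
  have hax : ∀ᶠ t in atTop, ‖a t - x‖ ≤ 1 := by
    simpa [dist_eq_norm] using ha.eventually (Metric.closedBall_mem_nhds x one_pos)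
  have hby : ∀ᶠ t in atTop, ‖b t - y‖ ≤ 1 := by
    simpa [dist_eq_norm] using hb.eventually (Metric.closedBall_mem_nhds y one_pos)
  have hab := eventually_norm_sub_sq_le ha hb
  filter_upwards [hax, hby, hab, eventually_gt_atTop 0] with t h1 h2 h3 ht k
  rw [bridgeOccupationMoment_eq_sum hv ht, Finset.mul_sum]
  refine Finset.sum_le_sum fun l _ => ?_
  set E : ENNReal := ENNReal.ofReal (Real.exp 1 * (k + 1 : ℝ) ^ ((d : ℝ) / 2)) with hE
  have hA : Set.Ioo ε (t - ε) ⊆ Set.Ioi ε := fun r hr => hr.1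
  have hinner : ∀ p : ℝ × Euc d, (visitStep d v (Set.Ioo ε (t - ε)) (Set.Ioo 0 (t / (k + 1))))^[l]
          (fun q => ENNReal.ofReal (heatKernel d t (b t - a t))⁻¹ *
            gapWeight d (Set.Ici (t / (k + 1))) t p q) (0, b t) ≤
        E * (D' * (visitStep d v (Set.Ioi ε) (Set.Ioi 0))^[l] (fun _ => 1) (0, y)) := fun p =>
    (visitStep_iterate_le hA (fun r hr => hr.1) ENNReal.ofReal_ne_top
      (fun q => gapWeight_div_le d k ht _ h3 p q) l _).trans (by gcongr; exact hD' _ h2 l)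
  have hy := occupationMoment_ne_top hd hvb hvs ε l y
  refine (visitStep_iterate_le hA subset_rfl (ENNReal.mul_ne_top ENNReal.ofReal_ne_top
    (ENNReal.mul_ne_top hDtop' hy)) hinner (k - l) _).trans ?_
  calc _ ≤ E * (D' * occupationMoment d v ε l y) * (D * occupationMoment d v ε (k - l) x) :=
        mul_le_mul' le_rfl (hD _ h1 (k - l))
    _ = _ := by
        rw [hE, ENNReal.ofReal_mul (Real.exp_pos _).le]; ring

theorem tendsto_bridgeOccupationMoment {d : ℕ} (hd : 3 ≤ d) {v : Euc d → ℝ} (hv : Measurable v)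
    (hvb : ∃ C : ℝ, ∀ z, |v z| ≤ C) (hvs : ∃ R : ℝ, ∀ z, v z ≠ 0 → ‖z‖ ≤ R) {ε : ℝ} (hε : 0 < ε)
    {a b : ℝ → Euc d} {x y : Euc d} (ha : Tendsto a atTop (𝓝 x)) (hb : Tendsto b atTop (𝓝 y))
    {k : ℕ} (hk : 1 ≤ k) :
    Tendsto (fun t => bridgeOccupationMoment d v ε t k (a t) (b t)) atTop
      (𝓝 (∑ l ∈ Finset.range (k + 1),
        occupationMoment d v ε (k - l) x * occupationMoment d v ε l y)) := by
  obtain ⟨B, hBtop, hB'⟩ := exists_lintegral_visitKernel_le hd hvb hvs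
  have hB := fun p => hB' (Set.Ioi ε) p measurableSet_Ioi
  have hfin := occupationMoment_ne_top hd hvb hvs ε
  have hA : ∀ t, Set.Ioo ε (t - ε) ⊆ Set.Ioi ε := fun t r hr => hr.1
  have hA' : ∀ r ∈ Set.Ioi ε, ∀ᶠ t : ℝ in atTop, r ∈ Set.Ioo ε (t - ε) := fun r hr => by
    filter_upwards [eventually_gt_atTop (r + ε)] with t ht
    exact ⟨hr, by linarith⟩
  have hS : ∀ t : ℝ, Set.Ioo 0 (t / (k + 1)) ⊆ Set.Ioi 0 := fun t r hr => hr.1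
  have hS' : ∀ r ∈ Set.Ioi (0 : ℝ), ∀ᶠ t : ℝ in atTop, r ∈ Set.Ioo 0 (t / (k + 1)) := fun r hr => by
    filter_upwards [eventually_gt_atTop (r * (k + 1))] with t ht
    exact ⟨hr, by rwa [lt_div_iff₀ (by positivity)]⟩
  have hab := eventually_norm_sub_sq_le ha hb
  let E : ENNReal := ENNReal.ofReal (Real.exp 1 * (k + 1 : ℝ) ^ ((d : ℝ) / 2))
  have hgm : ∀ t, Measurable (Function.uncurry fun p q : ℝ × Euc d =>
      ENNReal.ofReal (heatKernel d t (b t - a t))⁻¹ *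
        gapWeight d (Set.Ici (t / (k + 1))) t p q) := fun t =>
    (measurable_gapWeight d measurableSet_Ici t).const_mul _
  have hinner : ∀ (l : ℕ) {p : ℝ → ℝ × Euc d} {p₀ : ℝ × Euc d}, Tendsto p atTop (𝓝 p₀) →
      Tendsto (fun t => (visitStep d v (Set.Ioo ε (t - ε)) (Set.Ioo 0 (t / (k + 1))))^[l]
          (fun q => ENNReal.ofReal (heatKernel d t (b t - a t))⁻¹ *
            gapWeight d (Set.Ici (t / (k + 1))) t (p t) q) (0, b t)) atTop
        (𝓝 (occupationMoment d v ε l y)) := by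
    intro l p p₀ hp
    refine tendsto_visitStep_iterate_start hv hvs hε (fun _ => measurableSet_Ioo)
      (fun _ => measurableSet_Ioo) hA hA' hS hS' hB hBtop
      (fun t => (hgm t).comp measurable_prodMk_left) (c := E) ENNReal.ofReal_ne_top ?_ ?_ hb ?_ l
    · filter_upwards [hab, eventually_gt_atTop 0] with t h1 ht q
      exact gapWeight_div_le d k ht _ h1 _ _
    · exact fun q => tendsto_gapWeight_div d hk hp tendsto_const_nhds (hb.sub ha)
    · exact tendsto_gapWeight_div d hk hp (tendsto_const_nhds.prodMk_nhds hb) (hb.sub ha)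
  obtain ⟨D', hDtop', -, -, hD'⟩ := exists_visitStep_start_le hvs hε y
  have hby : ∀ᶠ t in atTop, ‖b t - y‖ ≤ 1 := by
    simpa [dist_eq_norm] using hb.eventually (Metric.closedBall_mem_nhds y one_pos)
  refine Tendsto.congr' ((eventually_gt_atTop 0).mono fun t ht =>
    (bridgeOccupationMoment_eq_sum hv ht (a t) (b t) k).symm)
    (tendsto_finsetSum _ fun l _ => ?_)
  have hlim : occupationMoment d v ε (k - l) x * occupationMoment d v ε l y =
      (visitStep d v (Set.Ioi ε) (Set.Ioi 0))^[k - l]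
        (fun _ => occupationMoment d v ε l y) (0, x) := by
    have := visitStep_iterate_const_mul (v := v) (A := Set.Ioi ε) (S := Set.Ioi 0)
      (hfin l y) (fun _ => 1) (k - l)
    simp only [mul_one] at this
    rw [this, mul_comm]
    rfl
  rw [hlim]
  refine tendsto_visitStep_iterate_start hv hvs hε (fun _ => measurableSet_Ioo)
      (fun _ => measurableSet_Ioi) hA hA' (fun _ => subset_rfl)
      (fun r hr => Eventually.of_forall fun _ => hr) hB hBtop
      (Φ₀ := fun _ => occupationMoment d v ε l y)
      (fun t => (measurable_visitStep_iterate_param hv measurableSet_Ioo measurableSet_Ioo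
        (hgm t) l).comp measurable_prodMk_right) (c := E * (D' * occupationMoment d v ε l y))
      ?_ ?_ ?_ ha ?_ (k - l)
  · exact ENNReal.mul_ne_top ENNReal.ofReal_ne_top (ENNReal.mul_ne_top hDtop' (hfin l y))
  · filter_upwards [hab, hby, eventually_gt_atTop 0] with t h1 h2 ht p
    refine (visitStep_iterate_le (hA t) (hS t) ENNReal.ofReal_ne_top
      (fun q => gapWeight_div_le d k ht _ h1 p q) l _).trans ?_
    gcongr
    exact hD' _ h2 l
  · exact fun p => hinner l tendsto_const_nhds
  · exact hinner l (tendsto_const_nhds.prodMk_nhds ha)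

theorem jointDensity_pos {d k : ℕ} (x : Euc d) {s : Fin k → ℝ} (hs : StrictMono s)
    (hs0 : ∀ i, 0 < s i) (z : Fin k → Euc d) : 0 < jointDensity d x s z := by
  rw [jointDensity_eq_prod_cons]
  exact Finset.prod_pos fun i _ =>
    heatKernel_pos d (sub_pos.2 ((strictMono_cons_zero_iff hs0).1 hs i)) _

theorem jointDensity_snoc {d k : ℕ} (x b : Euc d) (t : ℝ) (s : Fin (k + 1) → ℝ)
    (z : Fin (k + 1) → Euc d) :
    jointDensity d x (Fin.snoc s t : Fin (k + 2) → ℝ) (Fin.snoc z b : Fin (k + 2) → Euc d) =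
      jointDensity d x s z * heatKernel d (t - s (Fin.last k)) (b - z (Fin.last k)) := by
  have hsnoc : ∀ {β : Type} (w : Fin (k + 1) → β) (c : β) (j : ℕ) (hj : j < k + 2)
      (hj' : j < k + 1), (Fin.snoc w c : Fin (k + 2) → β) ⟨j, hj⟩ = w ⟨j, hj'⟩ := by
    intro β w c j hj hj'
    exact Fin.snoc_castSucc (α := fun _ => β) c w ⟨j, hj'⟩
  unfold jointDensity
  rw [Fin.prod_univ_castSucc]
  congr 1
  · refine Finset.prod_congr rfl fun j _ => ?_
    have hj : (j : ℕ) - 1 < k + 1 := lt_of_le_of_lt (Nat.sub_le _ _) j.isLt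
    simp only [Fin.snoc_castSucc, Fin.val_castSucc, hsnoc s t _ _ hj, hsnoc z b _ _ hj]
  · simp only [Fin.snoc_last, Fin.val_last, Nat.succ_ne_zero, if_false, Nat.add_sub_cancel,
      hsnoc s t k _ k.lt_succ_self, hsnoc z b k _ k.lt_succ_self]
    rfl

/-- A continuous process with a.e.-measurable marginals has a jointly measurable version. -/
theorem exists_measurable_uncurry_version {Ω E : Type*} [MeasurableSpace Ω] {μ : Measure Ω}
    [TopologicalSpace E] [TopologicalSpace.PseudoMetrizableSpace E] [MeasurableSpace E]
    [BorelSpace E] [Nonempty E] {X : ℝ → Ω → E} (hX : ∀ ω, Continuous fun s => X s ω)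
    (hXm : ∀ s, AEMeasurable (X s) μ) :
    ∃ X' : ℝ → Ω → E, Measurable (Function.uncurry X') ∧ ∀ᵐ ω ∂μ, ∀ s, X s ω = X' s ω := by
  classical
  let e : E := Classical.arbitrary E
  have hgood : ∀ᵐ ω ∂μ, ∀ r : ℚ, X r ω = (hXm r).mk (X r) ω :=
    ae_all_iff.2 fun r => (hXm r).ae_eq_mk
  let N := toMeasurable μ {ω | ¬ ∀ r : ℚ, X r ω = (hXm r).mk (X r) ω}
  have hN : MeasurableSet N := measurableSet_toMeasurable _ _
  have hNc : ∀ ω ∉ N, ∀ r : ℚ, X r ω = (hXm r).mk (X r) ω := by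
    intro ω hω
    by_contra h
    exact hω (subset_toMeasurable μ _ h)
  have hN0 : μ N = 0 := by rw [measure_toMeasurable]; exact hgood
  let X' : ℝ → Ω → E := fun s ω => if ω ∈ N then e else X s ω
  have hX'c : ∀ ω, Continuous fun s => X' s ω := by
    intro ω
    by_cases h : ω ∈ N
    · simpa [X', h] using continuous_const
    · simpa [X', h] using hX ω
  have hX'r : ∀ r : ℚ, Measurable (X' r) := by
    intro r
    have : X' r = fun ω => if ω ∈ N then e else (hXm r).mk (X r) ω := by
      ext ω
      by_cases h : ω ∈ N
      · simp [X', h]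
      · simp only [X', h, if_false]
        exact hNc ω h r
    rw [this]
    exact Measurable.ite hN measurable_const (hXm r).measurable_mk
  have hX'm : ∀ s, Measurable (X' s) := by
    intro s
    obtain ⟨u, hu, hus⟩ := mem_closure_iff_seq_limit.1 (Rat.isDenseEmbedding_coe_real.dense s)
    choose r hr using hu
    refine measurable_of_tendsto_metrizable (fun n => hX'r (r n)) (tendsto_pi_nhds.2 fun ω => ?_)
    simp only [hr]
    exact ((hX'c ω).tendsto s).comp hus
  refine ⟨X', ?_, ?_⟩
  · exact measurable_uncurry_of_continuous_of_measurable hX'c hX'm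
  · filter_upwards [measure_eq_zero_iff_ae_notMem.1 hN0] with ω hω s
    simp [X', hω]

theorem aemeasurable_of_map_eq_withDensity {Ω E : Type*} [MeasurableSpace Ω] [MeasurableSpace E]
    {μ : Measure Ω} {ν : Measure E} [NeZero ν] {Y : Ω → E} {g : E → ENNReal}
    (hg : Measurable g) (hg0 : ∀ z, g z ≠ 0)
    (h : μ.map Y = ν.withDensity g) : AEMeasurable Y μ := by
  by_contra hY
  rw [Measure.map_of_not_aemeasurable hY] at h
  rw [eq_comm, withDensity_eq_zero_iff hg.aemeasurable] at h
  obtain ⟨z, hz⟩ := h.exists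
  exact hg0 z hz

theorem IsBrownianMotion.aemeasurable {Ω : Type*} [MeasureSpace Ω] {d : ℕ} {x : Euc d}
    {W : ℝ → Ω → Euc d} (hW : IsBrownianMotion x W) {s : ℝ} (hs : 0 ≤ s) : AEMeasurable (W s) := by
  rcases hs.eq_or_lt with rfl | hs
  · rw [show W 0 = fun _ => x from funext hW.1]
    exact aemeasurable_const
  have hsm : StrictMono fun _ : Fin (0 + 1) => s := fun i j hij => by omega
  have h := aemeasurable_of_map_eq_withDensity (measurable_jointDensity x _).ennreal_ofReal
    (fun z => (ENNReal.ofReal_pos.2 (jointDensity_pos x hsm (fun _ => hs) z)).ne')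
    (hW.2.2 0 (fun _ => s) hsm fun _ => hs)
  exact (aemeasurable_pi_iff.1 h) 0

theorem bridgeDensity_eq {d k : ℕ} (t : ℝ) (ht : 0 < t) (a b : Euc d) {s : Fin (k + 1) → ℝ}
    (hs : StrictMono s) (hst : ∀ i, 0 < s i ∧ s i < t) (z : Fin (k + 1) → Euc d) :
    ENNReal.ofReal (bridgeDensity d t a b s z) = ENNReal.ofReal (jointDensity d a s z) *
      (ENNReal.ofReal (heatKernel d t (b - a))⁻¹ *
        gapWeight d (Set.Ioi 0) t (s (Fin.last k), z (Fin.last k)) (0, b)) := by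
  have h : 0 < t - s (Fin.last k) := sub_pos.2 (hst _).2
  rw [bridgeDensity, jointDensity_snoc, gapWeight, sub_zero,
    Set.indicator_of_mem (Set.mem_Ioi.2 h), Pi.one_apply, one_mul,
    ← ENNReal.ofReal_mul (inv_nonneg.2 (heatKernel_nonneg d ht.le _)),
    ← ENNReal.ofReal_mul (jointDensity_pos a hs (fun i => (hst i).1) z).le]
  congr 1
  ring

theorem IsBrownianBridge.aemeasurable {Ω : Type*} [MeasureSpace Ω] {d : ℕ} {t : ℝ} {a b : Euc d}
    {X : ℝ → Ω → Euc d} (hX : IsBrownianBridge t a b X) {s : ℝ} (hs : s ∈ Set.Icc 0 t) :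
    AEMeasurable (X s) := by
  rcases hs.1.eq_or_lt with rfl | h0
  · rw [show X 0 = fun _ => a from funext hX.1]
    exact aemeasurable_const
  rcases hs.2.eq_or_lt with rfl | h1
  · rw [show X s = fun _ => b from funext hX.2.1]
    exact aemeasurable_const
  have ht : 0 < t := h0.trans h1
  have hsm : StrictMono fun _ : Fin (0 + 1) => s := fun i j hij => by omega
  have h := hX.2.2.2 0 (fun _ => s) hsm fun _ => ⟨h0, h1⟩
  simp only [bridgeDensity_eq t ht a b hsm fun _ => ⟨h0, h1⟩] at h
  have hlast : Measurable fun z : Fin (0 + 1) → Euc d => ((s, z (Fin.last 0)) : ℝ × Euc d) :=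
    measurable_const.prodMk (measurable_pi_apply _)
  have hgap : Measurable fun z : Fin (0 + 1) → Euc d =>
      ENNReal.ofReal (heatKernel d t (b - a))⁻¹ *
        gapWeight d (Set.Ioi 0) t (s, z (Fin.last 0)) (0, b) :=
    ((measurable_gapWeight d measurableSet_Ioi t).comp
      (hlast.prodMk measurable_const)).const_mul _
  have h := aemeasurable_of_map_eq_withDensity
    ((measurable_jointDensity a _).ennreal_ofReal.mul hgap) ?_ h
  · exact (aemeasurable_pi_iff.1 h) 0
  · intro z
    refine mul_ne_zero (ENNReal.ofReal_pos.2 (jointDensity_pos a hsm (fun _ => h0) z)).ne'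
      (mul_ne_zero (ENNReal.ofReal_pos.2 (inv_pos.2 (heatKernel_pos d ht _))).ne' ?_)
    have h2 : 0 < t - s := sub_pos.2 h1
    simpa [gapWeight, h2] using heatKernel_pos d h2 _

/-- Moments of the occupation integral of Brownian motion. -/
theorem IsBrownianMotion.lintegral_pow_occupation {Ω : Type*} [MeasureSpace Ω]
    [IsProbabilityMeasure (ℙ : Measure Ω)] {d : ℕ} {v : Euc d → ℝ} (hv : Measurable v) {x : Euc d}
    {W : ℝ → Ω → Euc d} (hW : IsBrownianMotion x W) {ε : ℝ} (hε : 0 ≤ ε) :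
    AEMeasurable (fun ω => ∫⁻ s in Set.Ioi ε, ENNReal.ofReal (v (W s ω))) ∧
    ∀ k : ℕ, ∫⁻ ω, (∫⁻ s in Set.Ioi ε, ENNReal.ofReal (v (W s ω))) ^ k =
      (k.factorial : ENNReal) * occupationMoment d v ε k x := by
  obtain ⟨W', hW'm, hW'⟩ := exists_measurable_uncurry_version (μ := (ℙ : Measure Ω))
    (X := fun s ω => W (max 0 s) ω)
    (fun ω => (hW.2.1 ω).comp (continuous_const.max continuous_id))
    (fun s => hW.aemeasurable (le_max_left _ _))
  have heq : ∀ᵐ ω, ∀ s, 0 ≤ s → W s ω = W' s ω := by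
    filter_upwards [hW'] with ω h s hs
    rw [← h s, max_eq_right hs]
  have heq' : ∀ᵐ ω, ∫⁻ s in Set.Ioi ε, ENNReal.ofReal (v (W s ω)) =
      ∫⁻ s in Set.Ioi ε, ENNReal.ofReal (v (W' s ω)) := by
    filter_upwards [heq] with ω h
    exact setLIntegral_congr_fun measurableSet_Ioi fun s hs => by
      rw [h s (hε.trans (le_of_lt hs))]
  have hmeas : Measurable fun ω => ∫⁻ s in Set.Ioi ε, ENNReal.ofReal (v (W' s ω)) :=
    Measurable.lintegral_prod_left' (f := fun p : ℝ × Ω => ENNReal.ofReal (v (W' p.1 p.2)))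
      (hv.comp hW'm).ennreal_ofReal
  refine ⟨⟨_, hmeas, heq'⟩, fun k => ?_⟩
  have hpow : ∫⁻ ω, (∫⁻ s in Set.Ioi ε, ENNReal.ofReal (v (W s ω))) ^ k =
      ∫⁻ ω, (∫⁻ s in Set.Ioi ε, ENNReal.ofReal (v (W' s ω))) ^ k :=
    lintegral_congr_ae (heq'.mono fun ω h => by simp only [h])
  rw [hpow]
  cases k with
  | zero => simp [occupationMoment]
  | succ k =>
    refine _root_.lintegral_pow_occupation hv measurableSet_Ioi (Set.Ioi_subset_Ioi hε) hW'm x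
      (φ := fun _ => 1) measurable_const (fun j s hs hsA => ?_) k
    have hs0 : ∀ i, 0 < s i := fun i => hε.trans_lt (hsA i)
    simp only [mul_one]
    rw [← hW.2.2 j s hs hs0]
    refine Measure.map_congr ?_
    filter_upwards [heq] with ω h
    exact funext fun i => (h _ (hs0 i).le).symm

/-- Moments of the occupation integral of a Brownian bridge. -/
theorem IsBrownianBridge.lintegral_pow_occupation {Ω : Type*} [MeasureSpace Ω]
    [IsProbabilityMeasure (ℙ : Measure Ω)] {d : ℕ} {v : Euc d → ℝ} (hv : Measurable v)
    {t : ℝ} (ht : 0 < t) {a b : Euc d}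
    {X : ℝ → Ω → Euc d} (hX : IsBrownianBridge t a b X) {ε : ℝ} (hε : 0 ≤ ε) :
    AEMeasurable (fun ω => ∫⁻ s in Set.Ioo ε (t - ε), ENNReal.ofReal (v (X s ω))) ∧
    ∀ k : ℕ, ∫⁻ ω, (∫⁻ s in Set.Ioo ε (t - ε), ENNReal.ofReal (v (X s ω))) ^ k =
      (k.factorial : ENNReal) * bridgeOccupationMoment d v ε t k a b := by
  obtain ⟨X', hX'm, hX'⟩ := exists_measurable_uncurry_version (μ := (ℙ : Measure Ω))
    (X := fun s ω => X (max 0 (min t s)) ω)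
    (fun ω => (hX.2.2.1 ω).comp_continuous
      (continuous_const.max (continuous_const.min continuous_id))
      (fun s => ⟨le_max_left _ _, max_le ht.le (min_le_left _ _)⟩))
    (fun s => hX.aemeasurable ⟨le_max_left _ _, max_le ht.le (min_le_left _ _)⟩)
  have heq : ∀ᵐ ω, ∀ s ∈ Set.Icc 0 t, X s ω = X' s ω := by
    filter_upwards [hX'] with ω h s hs
    rw [← h s, min_eq_right hs.2, max_eq_right hs.1]
  have hA : Set.Ioo ε (t - ε) ⊆ Set.Ioo 0 t := fun s hs =>
    ⟨hε.trans_lt hs.1, hs.2.trans_le (sub_le_self _ hε)⟩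
  have heq' : ∀ᵐ ω, ∫⁻ s in Set.Ioo ε (t - ε), ENNReal.ofReal (v (X s ω)) =
      ∫⁻ s in Set.Ioo ε (t - ε), ENNReal.ofReal (v (X' s ω)) := by
    filter_upwards [heq] with ω h
    exact setLIntegral_congr_fun measurableSet_Ioo fun s hs => by
      rw [h s (Set.Ioo_subset_Icc_self (hA hs))]
  have hmeas : Measurable fun ω => ∫⁻ s in Set.Ioo ε (t - ε), ENNReal.ofReal (v (X' s ω)) :=
    Measurable.lintegral_prod_left' (f := fun p : ℝ × Ω => ENNReal.ofReal (v (X' p.1 p.2)))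
      (hv.comp hX'm).ennreal_ofReal
  refine ⟨⟨_, hmeas, heq'⟩, fun k => ?_⟩
  have hpow : ∫⁻ ω, (∫⁻ s in Set.Ioo ε (t - ε), ENNReal.ofReal (v (X s ω))) ^ k =
      ∫⁻ ω, (∫⁻ s in Set.Ioo ε (t - ε), ENNReal.ofReal (v (X' s ω))) ^ k :=
    lintegral_congr_ae (heq'.mono fun ω h => by simp only [h])
  rw [hpow]
  cases k with
  | zero =>
    have hq := heatKernel_pos d ht (b - a)
    simp only [pow_zero, lintegral_one, measure_univ, Nat.factorial_zero, Nat.cast_one, one_mul,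
      bridgeOccupationMoment, Function.iterate_zero, id, gapWeight, sub_zero,
      Set.indicator_of_mem (Set.mem_Ioi.2 ht), Pi.one_apply]
    rw [← ENNReal.ofReal_mul (inv_nonneg.2 hq.le), inv_mul_cancel₀ hq.ne', ENNReal.ofReal_one]
  | succ k =>
    refine _root_.lintegral_pow_occupation hv measurableSet_Ioo (fun s hs => (hA hs).1) hX'm a
      (((measurable_gapWeight d measurableSet_Ioi t).comp measurable_prodMk_right).const_mul _)
      (fun j s hs hsA => ?_) k
    have hs0 : ∀ i, 0 < s i ∧ s i < t := fun i => hA (hsA i)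
    have h1 := hX.2.2.2 j s hs hs0
    simp only [bridgeDensity_eq t ht a b hs hs0] at h1
    refine Eq.trans (Measure.map_congr ?_) h1
    filter_upwards [heq] with ω h
    exact funext fun i => (h _ ⟨(hs0 i).1.le, (hs0 i).2.le⟩).symm

theorem summable_pow_div_factorial_mul_factorial (C : ℝ) (j : ℕ) {δ β : ℝ} (hδ : |δ| < β) :
    Summable fun i : ℕ => |δ| ^ i / i.factorial * (C * (i + j).factorial / β ^ (i + j)) := by
  have hβ : 0 < β := (abs_nonneg _).trans_lt hδ
  have h1 : ‖|δ| / β‖ < 1 := by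
    rw [Real.norm_eq_abs, abs_of_nonneg (by positivity), div_lt_one hβ]
    exact hδ
  refine ((summable_descFactorial_mul_geometric_of_norm_lt_one j h1).mul_left
    (C / β ^ j)).congr fun i => ?_
  have h2 : ((i + j).factorial : ℝ) = i.factorial * (i + j).descFactorial j := by
    have := Nat.factorial_mul_descFactorial (Nat.le_add_left j i)
    rw [Nat.add_sub_cancel] at this
    exact_mod_cast this.symm
  rw [h2, div_pow, pow_add]
  have : (i.factorial : ℝ) ≠ 0 := by positivity
  field_simp

/-- Taylor expansion of the tilted moments of a nonnegative random variable. -/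
theorem hasSum_integral_pow_mul_exp {Ω : Type*} [MeasurableSpace Ω] {μ : Measure Ω}
    {Z : Ω → ℝ} (hZ0 : ∀ ω, 0 ≤ Z ω) (hZm : AEStronglyMeasurable Z μ)
    (hintegrable : ∀ k : ℕ, Integrable (fun ω => Z ω ^ k) μ)
    {C β : ℝ} (hbd : ∀ k : ℕ, ∫ ω, Z ω ^ k ∂μ ≤ C * k.factorial / β ^ k) {θ δ : ℝ} (hθ : θ ≤ 0)
    (hδ : |δ| < β) (j : ℕ) :
    (∀ i : ℕ, ‖δ ^ i / i.factorial * ∫ ω, Z ω ^ (i + j) * Real.exp (θ * Z ω) ∂μ‖ ≤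
      |δ| ^ i / i.factorial * (C * (i + j).factorial / β ^ (i + j))) ∧
    HasSum (fun i : ℕ => δ ^ i / i.factorial * ∫ ω, Z ω ^ (i + j) * Real.exp (θ * Z ω) ∂μ)
      (∫ ω, Z ω ^ j * Real.exp ((θ + δ) * Z ω) ∂μ) := by
  have hexp : ∀ ω, Real.exp (θ * Z ω) ≤ 1 := fun ω =>
    Real.exp_le_one_iff.2 (mul_nonpos_of_nonpos_of_nonneg hθ (hZ0 ω))
  have hintegrable' : ∀ k : ℕ, Integrable (fun ω => Z ω ^ k * Real.exp (θ * Z ω)) μ := by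
    intro k
    refine (hintegrable k).mono ((hZm.pow k).mul
      (Real.continuous_exp.comp_aestronglyMeasurable (hZm.const_mul θ))) (ae_of_all _ fun ω => ?_)
    rw [norm_mul, Real.norm_eq_abs (Real.exp _), abs_of_pos (Real.exp_pos _)]
    exact mul_le_of_le_one_right (norm_nonneg _) (hexp ω)
  have hle : ∀ k : ℕ, ∫ ω, Z ω ^ k * Real.exp (θ * Z ω) ∂μ ≤ C * k.factorial / β ^ k := by
    intro k
    refine le_trans (integral_mono (hintegrable' k) (hintegrable k) fun ω => ?_) (hbd k)
    exact mul_le_of_le_one_right (pow_nonneg (hZ0 ω) _) (hexp ω)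
  have h0 : ∀ k : ℕ, 0 ≤ ∫ ω, Z ω ^ k * Real.exp (θ * Z ω) ∂μ := fun k =>
    integral_nonneg fun ω => mul_nonneg (pow_nonneg (hZ0 ω) _) (Real.exp_pos _).le
  have hFi : ∀ i : ℕ, Integrable
      (fun ω => δ ^ i / i.factorial * (Z ω ^ (i + j) * Real.exp (θ * Z ω))) μ := fun i =>
    (hintegrable' _).const_mul _
  have hnorm : ∀ i : ℕ, ∫ ω, ‖δ ^ i / i.factorial * (Z ω ^ (i + j) * Real.exp (θ * Z ω))‖ ∂μ =
      |δ| ^ i / i.factorial * ∫ ω, Z ω ^ (i + j) * Real.exp (θ * Z ω) ∂μ := by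
    intro i
    rw [← integral_const_mul]
    refine integral_congr_ae (ae_of_all _ fun ω => ?_)
    simp only [norm_mul, norm_div, norm_pow, Real.norm_eq_abs, Nat.abs_cast, Real.abs_exp,
      abs_of_nonneg (hZ0 ω)]
  have hb : ∀ i : ℕ, |δ| ^ i / i.factorial * ∫ ω, Z ω ^ (i + j) * Real.exp (θ * Z ω) ∂μ ≤
      |δ| ^ i / i.factorial * (C * (i + j).factorial / β ^ (i + j)) := fun i =>
    mul_le_mul_of_nonneg_left (hle _) (by positivity)
  constructor
  · intro i
    refine le_trans (le_of_eq ?_) (hb i)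
    rw [norm_mul, norm_div, norm_pow, Real.norm_eq_abs, Real.norm_natCast,
      Real.norm_of_nonneg (h0 _)]
  · have h1 := hasSum_integral_of_summable_integral_norm hFi (by
      simp only [hnorm]
      exact Summable.of_nonneg_of_le (fun i => mul_nonneg (by positivity) (h0 _)) hb
        (summable_pow_div_factorial_mul_factorial C j hδ))
    simp only [integral_const_mul] at h1
    convert! h1 using 1
    refine integral_congr_ae (ae_of_all _ fun ω => ?_)
    have h2 := (NormedSpace.expSeries_div_hasSum_exp (δ * Z ω)).mul_left
      (Z ω ^ j * Real.exp (θ * Z ω))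
    rw [← Real.exp_eq_exp_ℝ, mul_assoc, ← Real.exp_add] at h2
    simp only [add_mul]
    rw [← h2.tsum_eq]
    refine tsum_congr fun i => ?_
    rw [mul_pow, pow_add]
    ring

theorem integral_pow_of_lintegral_le {Ω : Type*} [MeasurableSpace Ω] {μ : Measure Ω} {Z : Ω → ℝ}
    (h0 : ∀ ω, 0 ≤ Z ω) (hm : AEStronglyMeasurable Z μ) (k : ℕ) {r : ℝ} (hr : 0 ≤ r)
    (hle : ∫⁻ ω, ENNReal.ofReal (Z ω) ^ k ∂μ ≤ ENNReal.ofReal r) :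
    Integrable (fun ω => Z ω ^ k) μ ∧
      ∫ ω, Z ω ^ k ∂μ = (∫⁻ ω, ENNReal.ofReal (Z ω) ^ k ∂μ).toReal ∧
      ∫ ω, Z ω ^ k ∂μ ≤ r := by
  have h1 : ∀ ω, ENNReal.ofReal (Z ω) ^ k = ENNReal.ofReal (Z ω ^ k) := fun ω =>
    (ENNReal.ofReal_pow (h0 ω) k).symm
  simp only [h1] at hle ⊢
  have h2 : ∫ ω, Z ω ^ k ∂μ = (∫⁻ ω, ENNReal.ofReal (Z ω ^ k) ∂μ).toReal :=
    integral_eq_lintegral_of_nonneg_ae (ae_of_all _ fun ω => pow_nonneg (h0 ω) k) (hm.pow k)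
  refine ⟨⟨hm.pow k, ?_⟩, h2, ?_⟩
  · rw [hasFiniteIntegral_iff_ofReal (ae_of_all _ fun ω => pow_nonneg (h0 ω) k)]
    exact hle.trans_lt ENNReal.ofReal_lt_top
  · rw [h2]
    exact ENNReal.toReal_le_of_le_ofReal hr hle

/-- Convergence of all moments with a geometric bound on `E[Z ^ k] / k!` implies convergence of
the moment generating function up to the corresponding radius and on the whole negative axis. -/
theorem tendsto_integral_exp_of_tendsto_moments {ι Ω Ω' : Type*} {l : Filter ι} [l.NeBot]
    [MeasurableSpace Ω] [MeasurableSpace Ω'] {μ : Measure Ω} {ν : Measure Ω'}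
    {Z : ι → Ω → ℝ} {Y : Ω' → ℝ} (hZ0 : ∀ t ω, 0 ≤ Z t ω) (hY0 : ∀ ω, 0 ≤ Y ω)
    (hZm : ∀ᶠ t in l, AEStronglyMeasurable (Z t) μ) (hYm : AEStronglyMeasurable Y ν)
    (hmom : ∀ k : ℕ, Tendsto (fun t => ∫⁻ ω, ENNReal.ofReal (Z t ω) ^ k ∂μ) l
      (𝓝 (∫⁻ ω, ENNReal.ofReal (Y ω) ^ k ∂ν)))
    {α₁ : ℝ} (hα₁ : 0 < α₁)
    (hbd : ∀ β, 0 < β → β < α₁ → ∃ C : ℝ, ∀ᶠ t in l, ∀ k : ℕ,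
      ∫⁻ ω, ENNReal.ofReal (Z t ω) ^ k ∂μ ≤ ENNReal.ofReal (C * k.factorial / β ^ k))
    {α : ℝ} (hα : α < α₁) :
    Tendsto (fun t => ∫ ω, Real.exp (α * Z t ω) ∂μ) l (𝓝 (∫ ω, Real.exp (α * Y ω) ∂ν)) := by
  have hbdY : ∀ β, 0 < β → β < α₁ → ∃ C : ℝ, 0 ≤ C ∧ (∀ᶠ t in l, ∀ k : ℕ,
      ∫⁻ ω, ENNReal.ofReal (Z t ω) ^ k ∂μ ≤ ENNReal.ofReal (C * k.factorial / β ^ k)) ∧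
      ∀ k : ℕ, ∫⁻ ω, ENNReal.ofReal (Y ω) ^ k ∂ν ≤ ENNReal.ofReal (C * k.factorial / β ^ k) := by
    intro β h0 h1
    obtain ⟨C, hC⟩ := hbd β h0 h1
    have hC' : ∀ᶠ t in l, ∀ k : ℕ, ∫⁻ ω, ENNReal.ofReal (Z t ω) ^ k ∂μ ≤
        ENNReal.ofReal (max C 0 * k.factorial / β ^ k) := by
      filter_upwards [hC] with t ht k
      refine (ht k).trans (ENNReal.ofReal_le_ofReal ?_)
      gcongr
      exact le_max_left _ _
    exact ⟨max C 0, le_max_right _ _, hC', fun k => le_of_tendsto (hmom k)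
      (hC'.mono fun t ht => ht k)⟩
  let Q : ℝ → Prop := fun θ => ∀ j : ℕ,
    Tendsto (fun t => ∫ ω, Z t ω ^ j * Real.exp (θ * Z t ω) ∂μ) l
      (𝓝 (∫ ω, Y ω ^ j * Real.exp (θ * Y ω) ∂ν))
  have hQ0 : Q 0 := by
    intro j
    obtain ⟨C, hC0, hC, hCY⟩ := hbdY (α₁ / 2) (by positivity) (by linarith)
    have hr : ∀ k : ℕ, 0 ≤ C * k.factorial / (α₁ / 2) ^ k := fun k => by positivity
    simp only [zero_mul, Real.exp_zero, mul_one]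
    rw [(integral_pow_of_lintegral_le hY0 hYm j (hr j) (hCY j)).2.1]
    refine ((ENNReal.tendsto_toReal ((hCY j).trans_lt ENNReal.ofReal_lt_top).ne).comp
      (hmom j)).congr' ?_
    filter_upwards [hZm, hC] with t ht1 ht2
    exact (integral_pow_of_lintegral_le (hZ0 t) ht1 j (hr j) (ht2 j)).2.1.symm
  have hstep : ∀ θ ≤ 0, ∀ δ, |δ| < α₁ → Q θ → Q (θ + δ) := by
    intro θ hθ δ hδ hQ j
    obtain ⟨β, h1, h2⟩ := exists_between hδ
    have hβ : 0 < β := (abs_nonneg _).trans_lt h1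
    obtain ⟨C, hC0, hC, hCY⟩ := hbdY β hβ h2
    have hr : ∀ k : ℕ, 0 ≤ C * k.factorial / β ^ k := fun k => by positivity
    have hYs := hasSum_integral_pow_mul_exp hY0 hYm
      (fun k => (integral_pow_of_lintegral_le hY0 hYm k (hr k) (hCY k)).1)
      (fun k => (integral_pow_of_lintegral_le hY0 hYm k (hr k) (hCY k)).2.2) hθ h1 j
    have hZs := (hZm.and hC).mono fun t ht => hasSum_integral_pow_mul_exp (hZ0 t) ht.1
      (fun k => (integral_pow_of_lintegral_le (hZ0 t) ht.1 k (hr k) (ht.2 k)).1)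
      (fun k => (integral_pow_of_lintegral_le (hZ0 t) ht.1 k (hr k) (ht.2 k)).2.2) hθ h1 j
    rw [← hYs.2.tsum_eq]
    refine (tendsto_tsum_of_dominated_convergence
      (summable_pow_div_factorial_mul_factorial C j h1) (fun i => (hQ (i + j)).const_mul _)
      (hZs.mono fun t ht => ht.1)).congr' ?_
    filter_upwards [hZs] with t ht
    exact ht.2.tsum_eq
  have hneg : ∀ n : ℕ, ∀ δ, 0 ≤ δ → δ < α₁ → Q (-(n * δ)) := by
    intro n δ h0 h1
    induction n with
    | zero => simpa using hQ0
    | succ n ih =>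
      have := hstep (-(n * δ)) (by simp; positivity) (-δ) (by rwa [abs_neg, abs_of_nonneg h0]) ih
      convert! this using 1
      push_cast; ring
  have hQα : Q α := by
    rcases le_or_gt 0 α with h | h
    · simpa using hstep 0 le_rfl α (by rwa [abs_of_nonneg h]) hQ0
    · obtain ⟨n, hn⟩ := exists_nat_gt (-α / α₁)
      have hn0 : (0 : ℝ) < n := lt_of_le_of_lt (by have : 0 < -α := by linarith
                                                   positivity) hn
      have := hneg n (-α / n) (by have : 0 < -α := by linarith
                                  positivity) (by
        rw [div_lt_iff₀ hα₁] at hn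
        rw [div_lt_iff₀ hn0]; linarith)
      convert! this using 1
      field_simp
  simpa using hQα 0

/-- The occupation integral `∫_A v(X_s) ds`, with values in `[0, ∞]`. -/
def occupation {Ω : Type*} {d : ℕ} (v : Euc d → ℝ) (X : ℝ → Ω → Euc d) (A : Set ℝ) (ω : Ω) :
    ENNReal :=
  ∫⁻ s in A, ENNReal.ofReal (v (X s ω))

theorem occupation_le {Ω : Type*} {d : ℕ} {v : Euc d → ℝ} {C : ℝ} (hC : ∀ z, |v z| ≤ C)
    (X : ℝ → Ω → Euc d) (A : Set ℝ) (ω : Ω) :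
    occupation v X A ω ≤ ENNReal.ofReal C * volume A := by
  refine (lintegral_mono fun s => ENNReal.ofReal_le_ofReal ((le_abs_self _).trans (hC _))).trans ?_
  rw [lintegral_const, Measure.restrict_apply_univ]

theorem abs_toReal_occupation_sub_le {Ω : Type*} {d : ℕ} {v : Euc d → ℝ} {C : ℝ} (hC0 : 0 ≤ C)
    (hC : ∀ z, |v z| ≤ C) (X : ℝ → Ω → Euc d) {A B R : Set ℝ} (hAB : A ⊆ B) (hB : B ⊆ A ∪ R)
    {δ : ℝ} (hδ : 0 ≤ δ) (hR : volume R ≤ ENNReal.ofReal δ) {ω : Ω}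
    (hfin : occupation v X B ω ≠ ⊤) :
    |(occupation v X B ω).toReal - (occupation v X A ω).toReal| ≤ C * δ := by
  have h1 : occupation v X A ω ≤ occupation v X B ω := lintegral_mono_set hAB
  have hA : occupation v X A ω ≠ ⊤ := ne_top_of_le_ne_top hfin h1
  have h2 : occupation v X B ω ≤ occupation v X A ω + ENNReal.ofReal (C * δ) := by
    refine (lintegral_mono_set hB).trans ((lintegral_union_le _ _ _).trans ?_)
    refine add_le_add le_rfl ((occupation_le hC X R ω).trans ?_)
    rw [ENNReal.ofReal_mul hC0]
    gcongr
  rw [abs_of_nonneg (sub_nonneg.2 (ENNReal.toReal_mono hfin h1)), sub_le_iff_le_add']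
  calc _ ≤ (occupation v X A ω + ENNReal.ofReal (C * δ)).toReal :=
        ENNReal.toReal_mono (by finiteness) h2
    _ = _ := by
        rw [ENNReal.toReal_add hA (by finiteness), ENNReal.toReal_ofReal (by positivity)]

theorem pathInt_eq_toReal_occupation {Ω : Type*} [MeasureSpace Ω] {d : ℕ} {v : Euc d → ℝ}
    (hv : Measurable v) (hv0 : ∀ z, 0 ≤ v z) {t : ℝ} {a b : Euc d} {X : ℝ → Ω → Euc d}
    (hX : IsBrownianBridge t a b X) (ω : Ω) :
    pathInt v X t ω = (occupation v X (Set.Ioo 0 t) ω).toReal := by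
  have hm : AEMeasurable (fun s => X s ω) (volume.restrict (Set.Ioo 0 t)) :=
    ((hX.2.2.1 ω).mono Set.Ioo_subset_Icc_self).aemeasurable measurableSet_Ioo
  rw [pathInt, integral_Ioc_eq_integral_Ioo, integral_eq_lintegral_of_nonneg_ae
    (Eventually.of_forall fun s => hv0 _) (hv.comp_aemeasurable hm).aestronglyMeasurable]
  rfl

theorem pathIntInf_eq_toReal_occupation {Ω : Type*} [MeasureSpace Ω] {d : ℕ} {v : Euc d → ℝ}
    (hv : Measurable v) (hv0 : ∀ z, 0 ≤ v z) {x : Euc d} {W : ℝ → Ω → Euc d}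
    (hW : IsBrownianMotion x W) (ω : Ω) :
    pathIntInf v W ω = (occupation v W (Set.Ioi 0) ω).toReal := by
  rw [pathIntInf, integral_eq_lintegral_of_nonneg_ae
    (Eventually.of_forall fun s => hv0 _)
    (hv.comp (hW.2.1 ω).measurable).aestronglyMeasurable]
  rfl

theorem ae_occupation_ne_top {Ω : Type*} [MeasureSpace Ω] [IsProbabilityMeasure (ℙ : Measure Ω)]
    {d : ℕ} (hd : 3 ≤ d) {v : Euc d → ℝ} (hv : Measurable v) (hvb : ∃ C : ℝ, ∀ z, |v z| ≤ C)
    (hvs : ∃ R : ℝ, ∀ z, v z ≠ 0 → ‖z‖ ≤ R) {x : Euc d} {W : ℝ → Ω → Euc d}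
    (hW : IsBrownianMotion x W) {ε : ℝ} (hε : 0 ≤ ε) :
    ∀ᵐ ω, occupation v W (Set.Ioi ε) ω ≠ ⊤ := by
  obtain ⟨hm, hmom⟩ := hW.lintegral_pow_occupation hv hε
  have h1 : ∫⁻ ω, occupation v W (Set.Ioi ε) ω ≠ ⊤ := by
    have := hmom 1
    simp only [pow_one, Nat.factorial_one, Nat.cast_one, one_mul] at this
    exact this.trans_ne (occupationMoment_ne_top hd hvb hvs ε 1 x)
  filter_upwards [ae_lt_top' hm h1] with ω h using h.ne

theorem occupationMoment_le {Ω : Type*} [MeasureSpace Ω] [IsProbabilityMeasure (ℙ : Measure Ω)]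
    {d : ℕ} (hd : 3 ≤ d) {v : Euc d → ℝ} (hv : Measurable v) (hvb : ∃ C : ℝ, ∀ z, |v z| ≤ C)
    (hvs : ∃ R : ℝ, ∀ z, v z ≠ 0 → ‖z‖ ≤ R) (hv0 : ∀ z, 0 ≤ v z) {x : Euc d} {W : ℝ → Ω → Euc d}
    (hW : IsBrownianMotion x W) {ε : ℝ} (hε : 0 ≤ ε) {β : ℝ} (hβ : 0 < β) (k : ℕ) :
    occupationMoment d v ε k x ≤
      (∫⁻ ω, ENNReal.ofReal (Real.exp (β * pathIntInf v W ω))) * ENNReal.ofReal (β ^ k)⁻¹ := by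
  have hk : (k.factorial : ENNReal) ≠ 0 := by exact_mod_cast k.factorial_ne_zero
  rw [← ENNReal.mul_le_mul_iff_right hk (ENNReal.natCast_ne_top _),
    ← (hW.lintegral_pow_occupation hv hε).2 k, mul_left_comm,
    ← ENNReal.ofReal_natCast, ← ENNReal.ofReal_mul (by positivity),
    ← lintegral_mul_const' _ _ ENNReal.ofReal_ne_top]
  refine lintegral_mono_ae ?_
  filter_upwards [ae_occupation_ne_top hd hv hvb hvs hW le_rfl] with ω hω
  have h1 : occupation v W (Set.Ioi ε) ω ≤ occupation v W (Set.Ioi 0) ω :=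
    lintegral_mono_set (Set.Ioi_subset_Ioi hε)
  rw [← ENNReal.ofReal_mul (by positivity), pathIntInf_eq_toReal_occupation hv hv0 hW]
  refine (pow_le_pow_left' h1 k).trans ?_
  set y := (occupation v W (Set.Ioi 0) ω).toReal with hy
  have hy0 : 0 ≤ y := ENNReal.toReal_nonneg
  rw [← ENNReal.ofReal_toReal hω, ← hy, ← ENNReal.ofReal_pow hy0]
  refine ENNReal.ofReal_le_ofReal ?_
  have h2 := Real.pow_div_factorial_le_exp (β * y) (by positivity) k
  rw [div_le_iff₀ (by positivity), mul_pow] at h2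
  calc y ^ k = (β ^ k)⁻¹ * (β ^ k * y ^ k) := by field_simp
    _ ≤ (β ^ k)⁻¹ * (Real.exp (β * y) * k.factorial) := by gcongr
    _ = _ := by ring

theorem exists_forall_rpow_mul_pow_le (p : ℝ) {r : ℝ} (hr0 : 0 < r) (hr1 : r < 1) :
    ∃ K : ℝ, 0 ≤ K ∧ ∀ k : ℕ, (k + 1 : ℝ) ^ p * r ^ k ≤ K := by
  obtain ⟨n, hn⟩ := exists_nat_ge p
  obtain ⟨K, hK⟩ := (tendsto_pow_const_mul_const_pow_of_abs_lt_one n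
    (by rwa [abs_of_pos hr0])).bddAbove_range
  have hK' : ∀ k : ℕ, (k + 1 : ℝ) ^ p * r ^ k ≤ K / r := by
    intro k
    rw [le_div_iff₀ hr0]
    have h1 : ((k + 1 : ℕ) : ℝ) ^ n * r ^ (k + 1) ≤ K := hK ⟨k + 1, rfl⟩
    have h2 : (k + 1 : ℝ) ^ p ≤ (k + 1 : ℝ) ^ n := by
      rw [← Real.rpow_natCast]
      exact Real.rpow_le_rpow_of_exponent_le (by simp) hn
    push_cast at h1
    calc _ = (k + 1 : ℝ) ^ p * r ^ (k + 1) := by ring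
      _ ≤ (k + 1 : ℝ) ^ n * r ^ (k + 1) := by gcongr
      _ ≤ K := h1
  exact ⟨K / r, (by positivity : (0 : ℝ) ≤ (((0 : ℕ) : ℝ) + 1) ^ p * r ^ 0).trans (hK' 0), hK'⟩

/-- The moments of the bridge occupation integral grow at most like `k! / β ^ k` for subcritical
`β`. -/
theorem exists_bridgeOccupationMoment_le_div_pow {d : ℕ} (hd : 3 ≤ d) {v : Euc d → ℝ}
    (hv : Measurable v) (hvb : ∃ C : ℝ, ∀ z, |v z| ≤ C)
    (hvs : ∃ R : ℝ, ∀ z, v z ≠ 0 → ‖z‖ ≤ R) {ε : ℝ} (hε : 0 < ε) {a b : ℝ → Euc d} {x y : Euc d}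
    (ha : Tendsto a atTop (𝓝 x)) (hb : Tendsto b atTop (𝓝 y)) {β β' : ℝ} (hβ : 0 < β)
    (hββ' : β < β') {M N : ENNReal} (hM : M ≠ ⊤) (hN : N ≠ ⊤)
    (hMx : ∀ k, occupationMoment d v ε k x ≤ M * ENNReal.ofReal (β' ^ k)⁻¹)
    (hNy : ∀ k, occupationMoment d v ε k y ≤ N * ENNReal.ofReal (β' ^ k)⁻¹) :
    ∃ C : ℝ, ∀ᶠ t in atTop, ∀ k : ℕ, (k.factorial : ENNReal) *
      bridgeOccupationMoment d v ε t k (a t) (b t) ≤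
        ENNReal.ofReal (C * k.factorial / β ^ k) := by
  have hβ' : 0 < β' := hβ.trans hββ'
  obtain ⟨D, hD, hbd⟩ := exists_bridgeOccupationMoment_le hd hv hvb hvs hε ha hb
  obtain ⟨K, hK0, hK⟩ := exists_forall_rpow_mul_pow_le ((d : ℝ) / 2 + 1) (div_pos hβ hβ')
    ((div_lt_one hβ').2 hββ')
  refine ⟨(D * M * N).toReal * K, ?_⟩
  filter_upwards [hbd] with t ht k
  have hsum : ∑ l ∈ Finset.range (k + 1),
      occupationMoment d v ε (k - l) x * occupationMoment d v ε l y ≤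
      ENNReal.ofReal (k + 1) * (M * N * ENNReal.ofReal (β' ^ k)⁻¹) := by
    calc _ ≤ ∑ l ∈ Finset.range (k + 1), M * N * ENNReal.ofReal (β' ^ k)⁻¹ := by
          refine Finset.sum_le_sum fun l hl => ?_
          have hl' : l ≤ k := Nat.lt_succ_iff.1 (Finset.mem_range.1 hl)
          refine (mul_le_mul' (hMx _) (hNy _)).trans_eq ?_
          rw [mul_mul_mul_comm, ← ENNReal.ofReal_mul (by positivity), ← mul_inv, ← pow_add,
            Nat.sub_add_cancel hl']
      _ = _ := by
          rw [Finset.sum_const, Finset.card_range, nsmul_eq_mul, ← ENNReal.ofReal_natCast]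
          push_cast
          rfl
  calc _ ≤ (k.factorial : ENNReal) * (D * ENNReal.ofReal ((k + 1 : ℝ) ^ ((d : ℝ) / 2)) *
        (ENNReal.ofReal (k + 1) * (M * N * ENNReal.ofReal (β' ^ k)⁻¹))) := by
        gcongr
        exact (ht k).trans (by gcongr)
    _ = (D * M * N) * ENNReal.ofReal
        (k.factorial * ((k + 1 : ℝ) ^ ((d : ℝ) / 2 + 1) * (β' ^ k)⁻¹)) := by
        rw [Real.rpow_add_one (by positivity), ENNReal.ofReal_mul (by positivity),
          ENNReal.ofReal_mul (by positivity), ENNReal.ofReal_mul (by positivity),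
          ENNReal.ofReal_natCast]
        ring
    _ = ENNReal.ofReal ((D * M * N).toReal *
        (k.factorial * ((k + 1 : ℝ) ^ ((d : ℝ) / 2 + 1) * (β' ^ k)⁻¹))) := by
        rw [ENNReal.ofReal_mul ENNReal.toReal_nonneg, ENNReal.ofReal_toReal (by finiteness)]
    _ ≤ _ := by
        refine ENNReal.ofReal_le_ofReal ?_
        have h1 : (k + 1 : ℝ) ^ ((d : ℝ) / 2 + 1) * (β' ^ k)⁻¹ ≤ K / β ^ k := by
          rw [le_div_iff₀ (by positivity)]
          refine le_trans (le_of_eq ?_) (hK k)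
          rw [div_pow]
          ring
        calc _ ≤ (D * M * N).toReal * (k.factorial * (K / β ^ k)) := by gcongr
          _ = _ := by ring

theorem lintegral_add_pow_prod {Ω₁ Ω₂ : Type*} [MeasurableSpace Ω₁] [MeasurableSpace Ω₂]
    {μ : Measure Ω₁} {ν : Measure Ω₂} [SFinite μ] [SFinite ν] {f : Ω₁ → ENNReal} {g : Ω₂ → ENNReal}
    (hf : AEMeasurable f μ) (hg : AEMeasurable g ν) {m n : ℕ → ENNReal}
    (hm : ∀ k, ∫⁻ ω, f ω ^ k ∂μ = (k.factorial : ENNReal) * m k)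
    (hn : ∀ k, ∫⁻ ω, g ω ^ k ∂ν = (k.factorial : ENNReal) * n k) (k : ℕ) :
    ∫⁻ p, (f p.1 + g p.2) ^ k ∂(μ.prod ν) =
      (k.factorial : ENNReal) * ∑ l ∈ Finset.range (k + 1), m (k - l) * n l := by
  have hf' := hf.comp_fst (ν := ν)
  have hg' := hg.comp_snd (μ := μ)
  simp only [add_comm (f _), add_pow]
  have hterm : ∀ l ∈ Finset.range (k + 1), AEMeasurable
      (fun p : Ω₁ × Ω₂ => g p.2 ^ l * f p.1 ^ (k - l) * (k.choose l : ENNReal)) (μ.prod ν) :=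
    fun l _ => ((hg'.pow_const l).mul (hf'.pow_const (k - l))).mul_const _
  rw [lintegral_finsetSum' _ hterm, Finset.mul_sum]
  refine Finset.sum_congr rfl fun l hl => ?_
  have hl' : l ≤ k := Nat.lt_succ_iff.1 (Finset.mem_range.1 hl)
  rw [lintegral_mul_const' _ _ (ENNReal.natCast_ne_top _)]
  simp only [mul_comm (g _ ^ l)]
  rw [lintegral_prod_mul (hf.pow_const (k - l)) (hg.pow_const l), hm, hn,
    ← Nat.choose_mul_factorial_mul_factorial hl']
  push_cast
  ring

theorem ofReal_toReal_pow_ae_eq {Ω : Type*} [MeasurableSpace Ω] {μ : Measure Ω}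
    {f : Ω → ENNReal} (hf : ∀ᵐ ω ∂μ, f ω ≠ ⊤) (k : ℕ) :
    ∫⁻ ω, ENNReal.ofReal (f ω).toReal ^ k ∂μ = ∫⁻ ω, f ω ^ k ∂μ :=
  lintegral_congr_ae (hf.mono fun ω h => by simp only [ENNReal.ofReal_toReal h])

/-- Convergence of the moment generating functions of the occupation integrals with the initial
and final time intervals of length `ε` removed. -/
theorem tendsto_integral_exp_occupation {d : ℕ} (hd : 3 ≤ d) {v : Euc d → ℝ}
    (hv : Measurable v) (hvb : ∃ C : ℝ, ∀ z, |v z| ≤ C)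
    (hvs : ∃ R : ℝ, ∀ z, v z ≠ 0 → ‖z‖ ≤ R) (hv0 : ∀ z, 0 ≤ v z)
    {Ω' : Type*} [MeasureSpace Ω'] [IsProbabilityMeasure (ℙ : Measure Ω')]
    {W : Euc d → ℝ → Ω' → Euc d} (hW : ∀ a, IsBrownianMotion a (W a))
    {α₁ : ℝ} (hα₁ : 0 < α₁)
    (hfin : ∀ α : ℝ, α < α₁ → ∀ a : Euc d,
      (∫⁻ ω', ENNReal.ofReal (Real.exp (α * pathIntInf v (W a) ω'))) ≠ ⊤)
    {xf yf : ℝ → Euc d} {x y : Euc d}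
    (hx : Tendsto xf atTop (𝓝 x)) (hy : Tendsto yf atTop (𝓝 y))
    {Ω : Type*} [MeasureSpace Ω] [IsProbabilityMeasure (ℙ : Measure Ω)]
    {X : ℝ → ℝ → Ω → Euc d} (hX : ∀ t : ℝ, 0 < t → IsBrownianBridge t (xf t) (yf t) (X t))
    {ε : ℝ} (hε : 0 < ε) {α : ℝ} (hα : α < α₁) :
    Tendsto (fun t : ℝ => ∫ ω, Real.exp
        (α * (occupation v (X t) (Set.Ioo ε (t - ε)) ω).toReal)) atTop
      (𝓝 ((∫ ω', Real.exp (α * (occupation v (W x) (Set.Ioi ε) ω').toReal)) *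
        ∫ ω', Real.exp (α * (occupation v (W y) (Set.Ioi ε) ω').toReal))) := by
  obtain ⟨C, hC⟩ := id hvb
  have hWx := (hW x).lintegral_pow_occupation hv hε.le
  have hWy := (hW y).lintegral_pow_occupation hv hε.le
  have htopx := ae_occupation_ne_top hd hv hvb hvs (hW x) hε.le
  have htopy := ae_occupation_ne_top hd hv hvb hvs (hW y) hε.le
  have htopX : ∀ t ω, occupation v (X t) (Set.Ioo ε (t - ε)) ω ≠ ⊤ := fun t ω =>
    ne_top_of_le_ne_top (by rw [Real.volume_Ioo]; finiteness) (occupation_le hC _ _ ω)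
  have hmomX : ∀ t, 0 < t → ∀ k : ℕ,
      ∫⁻ ω, ENNReal.ofReal (occupation v (X t) (Set.Ioo ε (t - ε)) ω).toReal ^ k =
        (k.factorial : ENNReal) * bridgeOccupationMoment d v ε t k (xf t) (yf t) := fun t ht k =>
    (ofReal_toReal_pow_ae_eq (Eventually.of_forall (htopX t)) k).trans
      (((hX t ht).lintegral_pow_occupation hv ht hε.le).2 k)
  have htop : ∀ᵐ p ∂((ℙ : Measure Ω').prod (ℙ : Measure Ω')),
      occupation v (W x) (Set.Ioi ε) p.1 ≠ ⊤ ∧ occupation v (W y) (Set.Ioi ε) p.2 ≠ ⊤ :=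
    (Measure.quasiMeasurePreserving_fst.ae htopx).and
      (Measure.quasiMeasurePreserving_snd.ae htopy)
  have hmomY : ∀ k : ℕ, ∫⁻ p, ENNReal.ofReal ((occupation v (W x) (Set.Ioi ε) p.1).toReal +
      (occupation v (W y) (Set.Ioi ε) p.2).toReal) ^ k
        ∂((ℙ : Measure Ω').prod (ℙ : Measure Ω')) = (k.factorial : ENNReal) *
      ∑ l ∈ Finset.range (k + 1),
        occupationMoment d v ε (k - l) x * occupationMoment d v ε l y := by
    intro k
    refine Eq.trans (lintegral_congr_ae ?_)
      (lintegral_add_pow_prod hWx.1 hWy.1 hWx.2 hWy.2 k)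
    filter_upwards [htop] with p hp
    rw [ENNReal.ofReal_add ENNReal.toReal_nonneg ENNReal.toReal_nonneg,
      ENNReal.ofReal_toReal hp.1, ENNReal.ofReal_toReal hp.2]
    rfl
  rw [← integral_prod_mul]
  simp only [← Real.exp_add, ← mul_add]
  refine tendsto_integral_exp_of_tendsto_moments
    (fun _ _ => ENNReal.toReal_nonneg)
    (fun _ => add_nonneg ENNReal.toReal_nonneg ENNReal.toReal_nonneg) ?_ ?_ ?_ hα₁ ?_ hα
  · filter_upwards [eventually_gt_atTop 0] with t ht
    exact ((hX t ht).lintegral_pow_occupation hv ht hε.le).1.ennreal_toReal.aestronglyMeasurable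
  · exact (hWx.1.ennreal_toReal.comp_fst.add
      hWy.1.ennreal_toReal.comp_snd).aestronglyMeasurable
  · intro k
    rw [hmomY]
    rcases k.eq_zero_or_pos with rfl | hk
    · simp [occupationMoment]
    refine Tendsto.congr' ?_ (ENNReal.Tendsto.const_mul
      (tendsto_bridgeOccupationMoment hd hv hvb hvs hε hx hy hk)
      (Or.inr (ENNReal.natCast_ne_top _)))
    filter_upwards [eventually_gt_atTop 0] with t ht
    exact (hmomX t ht k).symm
  · intro β hβ hβ1
    obtain ⟨β', hββ', hβ'1⟩ := exists_between hβ1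
    obtain ⟨K, hK⟩ := exists_bridgeOccupationMoment_le_div_pow hd hv hvb hvs hε hx hy hβ hββ'
      (hfin β' hβ'1 x) (hfin β' hβ'1 y)
      (occupationMoment_le hd hv hvb hvs hv0 (hW x) hε.le (hβ.trans hββ'))
      (occupationMoment_le hd hv hvb hvs hv0 (hW y) hε.le (hβ.trans hββ'))
    refine ⟨K, ?_⟩
    filter_upwards [hK, eventually_gt_atTop 0] with t ht ht0 k
    exact (hmomX t ht0 k).trans_le (ht k)

theorem exp_mul_le_of_abs_sub_le (α : ℝ) {c z z' : ℝ} (h : |z - z'| ≤ c) :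
    Real.exp (α * z) ≤ Real.exp (|α| * c) * Real.exp (α * z') := by
  rw [← Real.exp_add, Real.exp_le_exp]
  have h1 : α * (z - z') ≤ |α| * c :=
    (le_abs_self _).trans ((abs_mul _ _).trans_le (by gcongr))
  linarith

theorem integrable_exp_of_abs_sub_le {Ω : Type*} [MeasurableSpace Ω] {μ : Measure Ω} (α : ℝ)
    {c : ℝ} {Z Z' : Ω → ℝ} (h : ∀ᵐ ω ∂μ, |Z ω - Z' ω| ≤ c) (hZ : AEMeasurable Z μ)
    (hZ' : Integrable (fun ω => Real.exp (α * Z' ω)) μ) :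
    Integrable (fun ω => Real.exp (α * Z ω)) μ := by
  refine (hZ'.const_mul (Real.exp (|α| * c))).mono'
    (Real.measurable_exp.comp_aemeasurable (hZ.const_mul α)).aestronglyMeasurable ?_
  filter_upwards [h] with ω hω
  rw [Real.norm_eq_abs, Real.abs_exp]
  exact exp_mul_le_of_abs_sub_le α hω

theorem integral_exp_le_of_abs_sub_le {Ω : Type*} [MeasurableSpace Ω] {μ : Measure Ω} (α : ℝ)
    {c : ℝ} {Z Z' : Ω → ℝ} (h : ∀ᵐ ω ∂μ, |Z ω - Z' ω| ≤ c)
    (hZ' : Integrable (fun ω => Real.exp (α * Z' ω)) μ) :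
    ∫ ω, Real.exp (α * Z ω) ∂μ ≤ Real.exp (|α| * c) * ∫ ω, Real.exp (α * Z' ω) ∂μ := by
  rw [← integral_const_mul]
  refine integral_mono_of_nonneg (Eventually.of_forall fun _ => (Real.exp_pos _).le)
    (hZ'.const_mul _) ?_
  filter_upwards [h] with ω hω using exp_mul_le_of_abs_sub_le α hω

/-- A function which is within multiplicative errors `exp (c * ε)` of functions with limits within
multiplicative errors `exp (c * ε)` of `m` converges to `m`. -/
theorem tendsto_of_forall_exp_mul_approx {ι : Type*} {l : Filter ι} {F : ι → ℝ} {m c : ℝ}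
    (h : ∀ ε > 0, ∃ (G : ι → ℝ) (g : ℝ), Tendsto G l (𝓝 g) ∧
      (∀ᶠ t in l, F t ≤ Real.exp (c * ε) * G t ∧ G t ≤ Real.exp (c * ε) * F t) ∧
      g ≤ Real.exp (c * ε) * m ∧ m ≤ Real.exp (c * ε) * g) :
    Tendsto F l (𝓝 m) := by
  have hexp : ∀ b : ℝ, Tendsto (fun ε : ℝ => Real.exp (b * ε) * m) (𝓝[>] 0) (𝓝 m) := by
    intro b
    have : ContinuousAt (fun ε : ℝ => Real.exp (b * ε) * m) 0 := by fun_prop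
    simpa using this.tendsto.mono_left nhdsWithin_le_nhds
  rw [tendsto_order]
  constructor
  · intro r hr
    obtain ⟨ε, hε, hε0⟩ := (((hexp (-(2 * c))).eventually (lt_mem_nhds hr)).and
      self_mem_nhdsWithin).exists
    obtain ⟨G, g, hG, hF, -, hg⟩ := h ε hε0
    have hlim : r < Real.exp (-(c * ε)) * g := by
      refine hε.trans_le ?_
      calc _ ≤ Real.exp (-(2 * c) * ε) * (Real.exp (c * ε) * g) := by gcongr
        _ = _ := by rw [← mul_assoc, ← Real.exp_add]; ring_nf
    filter_upwards [hF, (hG.const_mul (Real.exp (-(c * ε)))).eventually (lt_mem_nhds hlim)]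
      with t h1 h2
    refine h2.trans_le ?_
    calc _ ≤ Real.exp (-(c * ε)) * (Real.exp (c * ε) * F t) := by gcongr; exact h1.2
      _ = F t := by rw [← mul_assoc, ← Real.exp_add]; simp
  · intro r hr
    obtain ⟨ε, hε, hε0⟩ := (((hexp (2 * c)).eventually (gt_mem_nhds hr)).and
      self_mem_nhdsWithin).exists
    obtain ⟨G, g, hG, hF, hg, -⟩ := h ε hε0
    have hlim : Real.exp (c * ε) * g < r := by
      refine lt_of_le_of_lt ?_ hε
      calc _ ≤ Real.exp (c * ε) * (Real.exp (c * ε) * m) := by gcongr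
        _ = _ := by rw [← mul_assoc, ← Real.exp_add]; ring_nf
    filter_upwards [hF, (hG.const_mul (Real.exp (c * ε))).eventually (gt_mem_nhds hlim)]
      with t h1 h2
    exact h1.1.trans_lt h2

/-- Removing the time interval `(0, ε]` changes the moment generating function of the occupation
integral of Brownian motion at most by a factor close to one. -/
theorem integral_exp_pathIntInf_approx {d : ℕ} (hd : 3 ≤ d) {v : Euc d → ℝ}
    (hv : Measurable v) {C : ℝ} (hC0 : 0 ≤ C) (hC : ∀ z, |v z| ≤ C)
    (hvs : ∃ R : ℝ, ∀ z, v z ≠ 0 → ‖z‖ ≤ R) (hv0 : ∀ z, 0 ≤ v z)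
    {Ω : Type*} [MeasureSpace Ω] [IsProbabilityMeasure (ℙ : Measure Ω)] {a : Euc d}
    {W : ℝ → Ω → Euc d} (hW : IsBrownianMotion a W) {α : ℝ}
    (hfin : (∫⁻ ω, ENNReal.ofReal (Real.exp (α * pathIntInf v W ω))) ≠ ⊤) {ε : ℝ} (hε : 0 < ε) :
    (∫ ω, Real.exp (α * (occupation v W (Set.Ioi ε) ω).toReal) ≤
      Real.exp (|α| * (C * ε)) * ∫ ω, Real.exp (α * pathIntInf v W ω)) ∧
    ∫ ω, Real.exp (α * pathIntInf v W ω) ≤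
      Real.exp (|α| * (C * ε)) * ∫ ω, Real.exp (α * (occupation v W (Set.Ioi ε) ω).toReal) := by
  have hm : AEMeasurable fun ω => (occupation v W (Set.Ioi ε) ω).toReal :=
    (hW.lintegral_pow_occupation hv hε.le).1.ennreal_toReal
  have hm0 : AEMeasurable fun ω => pathIntInf v W ω := by
    simp only [pathIntInf_eq_toReal_occupation hv hv0 hW]
    exact (hW.lintegral_pow_occupation hv le_rfl).1.ennreal_toReal
  have hintegrable : Integrable fun ω => Real.exp (α * pathIntInf v W ω) := by
    refine ⟨(Real.measurable_exp.comp_aemeasurable (hm0.const_mul α)).aestronglyMeasurable, ?_⟩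
    rw [hasFiniteIntegral_iff_ofReal (Eventually.of_forall fun _ => (Real.exp_pos _).le)]
    exact hfin.lt_top
  have hdiff : ∀ᵐ ω, |pathIntInf v W ω - (occupation v W (Set.Ioi ε) ω).toReal| ≤ C * ε := by
    filter_upwards [ae_occupation_ne_top hd hv ⟨C, hC⟩ hvs hW le_rfl] with ω hω
    rw [pathIntInf_eq_toReal_occupation hv hv0 hW]
    refine abs_toReal_occupation_sub_le hC0 hC W (R := Set.Ioc 0 ε) (Set.Ioi_subset_Ioi hε.le)
      ?_ hε.le ?_ hω
    · rw [Set.union_comm, Set.Ioc_union_Ioi_eq_Ioi hε.le]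
    · rw [Real.volume_Ioc, sub_zero]
  have hdiff' := hdiff.mono fun ω h => (abs_sub_comm _ _).trans_le h
  exact ⟨integral_exp_le_of_abs_sub_le α hdiff' hintegrable, integral_exp_le_of_abs_sub_le α hdiff
    (integrable_exp_of_abs_sub_le α hdiff' hm hintegrable)⟩

/-- Removing the initial and final time intervals of length `ε` changes the moment generating
function of the path integral along a bridge at most by a factor close to one. -/
theorem integral_exp_pathInt_approx {d : ℕ} {v : Euc d → ℝ}
    (hv : Measurable v) {C : ℝ} (hC0 : 0 ≤ C) (hC : ∀ z, |v z| ≤ C) (hv0 : ∀ z, 0 ≤ v z)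
    {Ω : Type*} [MeasureSpace Ω] [IsProbabilityMeasure (ℙ : Measure Ω)] {t : ℝ} (ht : 0 < t)
    {a b : Euc d} {X : ℝ → Ω → Euc d} (hX : IsBrownianBridge t a b X) (α : ℝ)
    {ε : ℝ} (hε : 0 < ε) :
    (∫ ω, Real.exp (α * pathInt v X t ω) ≤ Real.exp (|α| * (C * (2 * ε))) *
      ∫ ω, Real.exp (α * (occupation v X (Set.Ioo ε (t - ε)) ω).toReal)) ∧
    ∫ ω, Real.exp (α * (occupation v X (Set.Ioo ε (t - ε)) ω).toReal) ≤
      Real.exp (|α| * (C * (2 * ε))) * ∫ ω, Real.exp (α * pathInt v X t ω) := by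
  have hle : ∀ ω, occupation v X (Set.Ioo 0 t) ω ≤ ENNReal.ofReal C * ENNReal.ofReal t := by
    intro ω
    simpa using occupation_le hC X (Set.Ioo 0 t) ω
  have hfin : ∀ ω, occupation v X (Set.Ioo 0 t) ω ≠ ⊤ := fun ω =>
    ne_top_of_le_ne_top (by finiteness) (hle ω)
  have hm : AEMeasurable fun ω => (occupation v X (Set.Ioo ε (t - ε)) ω).toReal :=
    (hX.lintegral_pow_occupation hv ht hε.le).1.ennreal_toReal
  have hm0 : AEMeasurable fun ω => pathInt v X t ω := by
    simp only [pathInt_eq_toReal_occupation hv hv0 hX]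
    simpa [occupation] using (hX.lintegral_pow_occupation hv ht le_rfl).1.ennreal_toReal
  have hintegrable : Integrable fun ω => Real.exp (α * pathInt v X t ω) := by
    refine integrable_exp_of_abs_sub_le (Z' := fun _ => 0) (c := C * t) α
      (Eventually.of_forall fun ω => ?_) hm0 (integrable_const _)
    rw [pathInt_eq_toReal_occupation hv hv0 hX, sub_zero, abs_of_nonneg ENNReal.toReal_nonneg]
    refine ENNReal.toReal_le_of_le_ofReal (by positivity) ?_
    rw [ENNReal.ofReal_mul hC0]
    exact hle ω
  have hdiff : ∀ᵐ ω, |pathInt v X t ω - (occupation v X (Set.Ioo ε (t - ε)) ω).toReal| ≤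
      C * (2 * ε) := by
    refine Eventually.of_forall fun ω => ?_
    rw [pathInt_eq_toReal_occupation hv hv0 hX]
    refine abs_toReal_occupation_sub_le hC0 hC X (R := Set.Ioc 0 ε ∪ Set.Ico (t - ε) t)
      (Set.Ioo_subset_Ioo hε.le (by linarith)) ?_ (by positivity) ?_ (hfin ω)
    · intro s hs
      by_cases h1 : s ≤ ε
      · exact Or.inr (Or.inl ⟨hs.1, h1⟩)
      by_cases h2 : s < t - ε
      · exact Or.inl ⟨not_le.1 h1, h2⟩
      · exact Or.inr (Or.inr ⟨not_lt.1 h2, hs.2⟩)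
    · refine (measure_union_le _ _).trans_eq ?_
      rw [Real.volume_Ioc, Real.volume_Ico, ← ENNReal.ofReal_add (by linarith) (by linarith)]
      ring_nf
  have hdiff' := hdiff.mono fun ω h => (abs_sub_comm _ _).trans_le h
  exact ⟨integral_exp_le_of_abs_sub_le α hdiff
    (integrable_exp_of_abs_sub_le α hdiff' hm hintegrable),
    integral_exp_le_of_abs_sub_le α hdiff' hintegrable⟩

/-- Theorem 1 for nonnegative `v`: m.g.f. convergence on the whole subcritical range `α < α₁`. -/
theorem stmt15 (d : ℕ) (hd : 3 ≤ d) (v : Euc d → ℝ)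
    (hvm : Measurable v) (hvb : ∃ C : ℝ, ∀ z, |v z| ≤ C)
    (hvs : ∃ R : ℝ, ∀ z, v z ≠ 0 → ‖z‖ ≤ R) (hv0 : ∀ z, 0 ≤ v z)
    {Ω' : Type*} [MeasureSpace Ω'] [IsProbabilityMeasure (ℙ : Measure Ω')]
    (W : Euc d → ℝ → Ω' → Euc d) (hW : ∀ a, IsBrownianMotion a (W a))
    (α₁ : ℝ) (hα₁ : 0 < α₁)
    (hfin : ∀ α : ℝ, α < α₁ → ∀ a : Euc d,
      (∫⁻ ω', ENNReal.ofReal (Real.exp (α * pathIntInf v (W a) ω'))) ≠ ⊤)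
    (hinf : ∀ α : ℝ, α₁ < α → ∀ a : Euc d,
      (∫⁻ ω', ENNReal.ofReal (Real.exp (α * pathIntInf v (W a) ω'))) = ⊤)
    (xf yf : ℝ → Euc d) (x y : Euc d)
    (hx : Tendsto xf atTop (𝓝 x)) (hy : Tendsto yf atTop (𝓝 y))
    {Ω : Type*} [MeasureSpace Ω] [IsProbabilityMeasure (ℙ : Measure Ω)]
    (X : ℝ → ℝ → Ω → Euc d) (hX : ∀ t : ℝ, 0 < t → IsBrownianBridge t (xf t) (yf t) (X t)) :
    ∀ α : ℝ, α < α₁ →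
      Tendsto (fun t : ℝ => ∫ ω, Real.exp (α * pathInt v (X t) t ω)) atTop
        (𝓝 ((∫ ω', Real.exp (α * pathIntInf v (W x) ω')) *
            (∫ ω', Real.exp (α * pathIntInf v (W y) ω')))) := by
  intro α hα
  obtain ⟨C, hC⟩ := id hvb
  have hC0 : 0 ≤ C := (abs_nonneg _).trans (hC 0)
  refine tendsto_of_forall_exp_mul_approx (c := 2 * |α| * C) fun ε hε => ⟨_, _,
    tendsto_integral_exp_occupation hd hvm hvb hvs hv0 hW hα₁ hfin hx hy hX hε hα, ?_, ?_⟩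
  · filter_upwards [eventually_gt_atTop 0] with t ht
    have h := integral_exp_pathInt_approx hvm hC0 hC hv0 ht (hX t ht) α hε
    rwa [show |α| * (C * (2 * ε)) = 2 * |α| * C * ε by ring] at h
  · have h1 := integral_exp_pathIntInf_approx hd hvm hC0 hC hvs hv0 (hW x) (hfin α hα x) hε
    have h2 := integral_exp_pathIntInf_approx hd hvm hC0 hC hvs hv0 (hW y) (hfin α hα y) hε
    have hpos : ∀ {Ω₀ : Type _} [MeasureSpace Ω₀] (Z : Ω₀ → ℝ),
        0 ≤ ∫ ω, Real.exp (α * Z ω) := fun Z => integral_nonneg fun _ => (Real.exp_pos _).le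
    have hexp : Real.exp (2 * |α| * C * ε) =
        Real.exp (|α| * (C * ε)) * Real.exp (|α| * (C * ε)) := by
      rw [← Real.exp_add]
      ring_nf
    rw [hexp]
    constructor
    · rw [mul_mul_mul_comm]
      exact mul_le_mul h1.1 h2.1 (hpos _) (mul_nonneg (Real.exp_pos _).le (hpos _))
    · rw [mul_mul_mul_comm]
      exact mul_le_mul h1.2 h2.2 (hpos _) (mul_nonneg (Real.exp_pos _).le (hpos _))

end
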